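/- If G is a finite nonabelian simple group whose order divides 2^6 · 3^2 · p for a prime p, then p ≤ 17. -/

import Mathlib

section TwoSidedTrace

open Module

theorem trace_mulLeftRight_pi_matrix {ι : Type*} [Fintype ι] [DecidableEq ι] (d : ι → ℕ)
    (x y : ∀ i, Matrix (Fin (d i)) (Fin (d i)) ℂ) :
    LinearMap.trace ℂ _ (LinearMap.mulLeftRight ℂ (x, y)) =
      ∑ i, (x i).trace * (y i).trace := by
  classical
  let b := Pi.basis (fun i : ι => Matrix.stdBasis ℂ (Fin (d i)) (Fin (d i)))
  rw [LinearMap.trace_eq_matrix_trace ℂ b, Matrix.trace, Fintype.sum_sigma]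
  refine Finset.sum_congr rfl fun i _ => ?_
  simp only [Matrix.trace, Matrix.diag_apply, Finset.sum_mul_sum, Fintype.sum_prod_type]
  refine Finset.sum_congr rfl fun k _ => Finset.sum_congr rfl fun l _ => ?_
  rw [LinearMap.toMatrix_apply]
  simp [b, Pi.basis_apply, Pi.basis_repr, LinearMap.mulLeftRight_apply, Matrix.mul_apply,
    Matrix.stdBasis, Pi.single_apply, ite_apply]

theorem trace_mulLeftRight_single {G : Type*} [Group G] [Finite G] (g h : G) :
    LinearMap.trace ℂ _ (LinearMap.mulLeftRight ℂ
      (MonoidAlgebra.single g (1 : ℂ), MonoidAlgebra.single h (1 : ℂ))) =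
      (Nat.card {z : G // g * z * h = z} : ℂ) := by
  classical
  have := Fintype.ofFinite G
  rw [LinearMap.trace_eq_matrix_trace ℂ (MonoidAlgebra.basis G ℂ), Matrix.trace]
  simp [LinearMap.toMatrix_apply, MonoidAlgebra.basis, LinearMap.mulLeftRight_apply,
    MonoidAlgebra.single_mul_single, Finsupp.single_apply, Nat.card_eq_fintype_card,
    Fintype.card_subtype]

end TwoSidedTrace

section Integrality

theorem Matrix.isIntegral_of_mulVec_eq_smul {n : Type*} [Fintype n] [DecidableEq n]
    {M : Matrix n n ℂ} (hM : ∀ i j, IsIntegral ℤ (M i j)) {r : ℂ} {v : n → ℂ} (hv : v ≠ 0)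
    (h : M.mulVec v = r • v) : IsIntegral ℤ r := by
  let N : Matrix n n (integralClosure ℤ ℂ) := fun i j => ⟨M i j, hM i j⟩
  have hN : N.map (algebraMap (integralClosure ℤ ℂ) ℂ) = M := rfl
  have hdet : (Matrix.scalar n r - M).det = 0 := by
    refine Matrix.exists_mulVec_eq_zero_iff.1 ⟨v, hv, ?_⟩
    rw [Matrix.sub_mulVec, h]
    simp [Matrix.scalar_apply, ← Matrix.smul_one_eq_diagonal, Matrix.smul_mulVec]
  rw [← Matrix.eval_charpoly, ← hN, Matrix.charpoly_map, Polynomial.eval_map] at hdet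
  have : IsIntegral (integralClosure ℤ ℂ) r := ⟨N.charpoly, N.charpoly_monic, hdet⟩
  exact isIntegral_trans r this

theorem Matrix.isIntegral_trace_of_pow_eq_one {n : Type*} [Fintype n] [DecidableEq n]
    {M : Matrix n n ℂ} {k : ℕ} (hk : 0 < k) (hM : M ^ k = 1) : IsIntegral ℤ M.trace := by
  rw [Matrix.trace_eq_sum_roots_charpoly_of_splits (IsAlgClosed.splits _)]
  refine IsIntegral.multiset_sum fun r hr => ?_
  rw [Polynomial.mem_roots M.charpoly_monic.ne_zero, Polynomial.IsRoot, Matrix.eval_charpoly] at hr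
  obtain ⟨v, hv, h⟩ := Matrix.exists_mulVec_eq_zero_iff.2 hr
  have h1 : M.mulVec v = r • v := by
    rw [Matrix.sub_mulVec, sub_eq_zero] at h
    rw [← h]
    simp [Matrix.scalar_apply, ← Matrix.smul_one_eq_diagonal, Matrix.smul_mulVec]
  have h2 : ∀ m : ℕ, (M ^ m).mulVec v = r ^ m • v := by
    intro m
    induction m with
    | zero => simp
    | succ m ih => rw [pow_succ, ← Matrix.mulVec_mulVec, h1, Matrix.mulVec_smul, ih, smul_smul,
        pow_succ']
  have h3 := h2 k
  rw [hM, Matrix.one_mulVec] at h3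
  have h4 : r ^ k = 1 := by
    obtain ⟨i, hi⟩ := Function.ne_iff.1 hv
    have := congrFun h3 i
    simp only [Pi.smul_apply, smul_eq_mul] at this
    exact mul_right_cancel₀ hi (by rw [← this, one_mul])
  exact IsIntegral.of_pow hk (h4 ▸ isIntegral_one)

theorem Nat.dvd_of_isIntegral_div {a b : ℕ} (hb : b ≠ 0) (h : IsIntegral ℤ ((a : ℂ) / b)) :
    b ∣ a := by
  have h1 : IsIntegral ℤ ((a : ℚ) / b) := by
    rw [← isIntegral_algebraMap_iff (algebraMap ℚ ℂ).injective]
    simpa using h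
  obtain ⟨y, hy⟩ := IsIntegrallyClosed.isIntegral_iff.1 h1
  have hb' : (b : ℚ) ≠ 0 := by exact_mod_cast hb
  have h2 : (a : ℚ) = b * y := by
    rw [eq_comm, div_eq_iff hb'] at hy
    rw [hy, mul_comm]; simp
  exact Int.natCast_dvd_natCast.1 ⟨y, by exact_mod_cast h2⟩

end Integrality

section Wedderburn

variable {G : Type*} [Group G] [Finite G] {ι : Type*} [Fintype ι] {d : ι → ℕ}
  (φ : MonoidAlgebra ℂ G ≃ₐ[ℂ] ∀ i, Matrix (Fin (d i)) (Fin (d i)) ℂ)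

include φ

theorem sum_trace_mul_trace_single (g h : G) :
    ∑ i, (φ (.single g 1) i).trace * (φ (.single h 1) i).trace =
      (Nat.card {z : G // g * z * h = z} : ℂ) := by
  classical
  rw [← trace_mulLeftRight_single, ← trace_mulLeftRight_pi_matrix,
    ← LinearMap.trace_conj' _ φ.toLinearEquiv, AlgEquiv.linearEquivConj_mulLeftRight]
  rfl

theorem card_mul_coeff (x : MonoidAlgebra ℂ G) (g : G) :
    (Nat.card G : ℂ) * x.coeff g = ∑ i, d i * (φ (x * .single g⁻¹ 1) i).trace := by
  classical
  induction x using MonoidAlgebra.induction_linear with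
  | zero => simp
  | add f k hf hk => simp [mul_add, add_mul, hf, hk, Finset.sum_add_distrib]
  | single h r =>
    have h1 := sum_trace_mul_trace_single φ (h * g⁻¹) 1
    have h2 : φ (.single (1 : G) (1 : ℂ)) = 1 := map_one φ
    have h3 : (MonoidAlgebra.single h r : MonoidAlgebra ℂ G) * .single g⁻¹ 1 =
        r • .single (h * g⁻¹) 1 := by simp [MonoidAlgebra.single_mul_single]
    simp only [h3, map_smul, Pi.smul_apply, Matrix.trace_smul, smul_eq_mul]
    simp only [h2, Pi.one_apply, Matrix.trace_one, Fintype.card_fin] at h1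
    have h4 : ∀ i, (d i : ℂ) * (r * (φ (.single (h * g⁻¹) 1) i).trace) =
        r * ((φ (.single (h * g⁻¹) 1) i).trace * d i) := fun i => by ring
    simp only [h4, ← Finset.mul_sum, h1]
    by_cases hg : h = g
    · subst hg; simp [mul_comm]
    · have : IsEmpty {z : G // h * g⁻¹ * z * 1 = z} :=
        ⟨fun ⟨z, hz⟩ => hg (by simpa [mul_inv_eq_one] using hz)⟩
      rw [Nat.card_of_isEmpty (α := {z : G // h * g⁻¹ * z * 1 = z})]
      simp [hg]

theorem degree_dvd_card (i : ι) (hi : d i ≠ 0) : d i ∣ Nat.card G := by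
  classical
  have := Fintype.ofFinite G
  let e : MonoidAlgebra ℂ G := φ.symm (Pi.single i 1)
  have hne : Nonempty (Fin (d i)) := ⟨⟨0, Nat.pos_of_ne_zero hi⟩⟩
  have hφe : φ e = Pi.single i 1 := by simp [e]
  have he0 : e ≠ 0 := by
    intro h
    have h1 := congrFun (hφe.symm.trans (by rw [h, map_zero])) i
    simp at h1
  have hee : e * e = e := by
    apply φ.injective
    rw [map_mul, hφe, ← Pi.single_mul, mul_one]
  have hd : (d i : ℂ) ≠ 0 := by exact_mod_cast hi
  have hc : ∀ g : G, (Nat.card G : ℂ) * e.coeff g = d i * (φ (.single g⁻¹ 1) i).trace := by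
    intro g
    rw [card_mul_coeff φ, Finset.sum_eq_single i]
    · simp [hφe]
    · intro j _ hj
      simp [hφe, hj]
    · simp
  have hmul : ∀ z : G, e.coeff z = ∑ w, e.coeff (z * w⁻¹) * e.coeff w := by
    intro z
    conv_lhs => rw [← hee]
    rw [MonoidAlgebra.coeff_mul_apply_right, Finsupp.sum_fintype _ _ (by simp)]
  refine Nat.dvd_of_isIntegral_div hi (Matrix.isIntegral_of_mulVec_eq_smul
    (M := fun z w : G => (φ (.single (w * z⁻¹) 1) i).trace) (v := e.coeff) ?_ ?_ ?_)
  · intro z w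
    refine Matrix.isIntegral_trace_of_pow_eq_one (Nat.card_pos (α := G)) ?_
    rw [← Pi.pow_apply, ← map_pow, MonoidAlgebra.single_pow]
    simp only [pow_card_eq_one', one_pow]
    exact congrFun (map_one φ) i
  · intro h
    exact he0 (by ext g; simpa using congrFun h g)
  · ext z
    simp only [Matrix.mulVec, dotProduct, Pi.smul_apply, smul_eq_mul]
    rw [hmul z, Finset.mul_sum]
    refine Finset.sum_congr rfl fun w _ => ?_
    have := hc (z * w⁻¹)
    rw [mul_inv_rev, inv_inv] at this
    field_simp
    linear_combination (-(e.coeff w)) * this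

end Wedderburn

section TrivialBlock

theorem MonoidHom.eq_one_of_isSimpleGroup {G : Type*} [Group G] (hG : IsSimpleGroup G)
    (hnab : ¬ ∀ a b : G, a * b = b * a) {M : Type*} [CommMonoid M] (f : G →* M) (g : G) :
    f g = 1 := by
  rcases hG.eq_bot_or_eq_top_of_normal f.ker inferInstance with h | h
  · refine absurd (fun a b => ?_) hnab
    have h1 : a * b * (b * a)⁻¹ ∈ f.ker := by
      rw [MonoidHom.mem_ker, map_mul, map_mul, mul_comm (f a), ← map_mul, ← map_mul,
        mul_inv_cancel, map_one]
    rw [h, Subgroup.mem_bot, mul_inv_eq_one] at h1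
    exact h1
  · exact MonoidHom.mem_ker.1 (h ▸ Subgroup.mem_top g)

theorem Matrix.eq_scalar_of_card_eq_one {n : Type*} [Fintype n] [DecidableEq n]
    (hn : Fintype.card n = 1) (M : Matrix n n ℂ) : M = M.det • (1 : Matrix n n ℂ) := by
  obtain ⟨x, hx⟩ := Fintype.card_eq_one_iff.1 hn
  let _ : Unique n := ⟨⟨x⟩, hx⟩
  ext i j
  simp [Matrix.det_unique, hx i, hx j, hx default]

variable {G : Type*} [Group G] {ι : Type*} {d : ι → ℕ}
  (φ : MonoidAlgebra ℂ G ≃ₐ[ℂ] ∀ i, Matrix (Fin (d i)) (Fin (d i)) ℂ)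

include φ

theorem map_single_eq_one_of_degree_eq_one (hG : IsSimpleGroup G)
    (hnab : ¬ ∀ a b : G, a * b = b * a) {i : ι} (hi : d i = 1) (g : G) :
    φ (.single g 1) i = 1 := by
  let f : G →* ℂ :=
    { toFun := fun g => (φ (.single g 1) i).det
      map_one' := by
        have : φ (.single (1 : G) (1 : ℂ)) = 1 := map_one φ
        simp [this]
      map_mul' := fun x y => by
        have : (MonoidAlgebra.single (x * y) (1 : ℂ) : MonoidAlgebra ℂ G) =
          .single x 1 * .single y 1 := by simp [MonoidAlgebra.single_mul_single]
        rw [this, map_mul, Pi.mul_apply, Matrix.det_mul] }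
  have h := MonoidHom.eq_one_of_isSimpleGroup hG hnab f g
  rw [Matrix.eq_scalar_of_card_eq_one (by simpa using hi) (φ (.single g 1) i)]
  have h' : (φ (.single g 1) i).det = 1 := h
  rw [h', one_smul]

theorem degree_eq_one_unique (hG : IsSimpleGroup G)
    (hnab : ¬ ∀ a b : G, a * b = b * a) {i j : ι} (hi : d i = 1) (hj : d j = 1) : i = j := by
  classical
  have key : ∀ x : MonoidAlgebra ℂ G, (φ x i).trace = (φ x j).trace := by
    intro x
    induction x using MonoidAlgebra.induction_linear with
    | zero => simp
    | add f k hf hk => simp [hf, hk]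
    | single g r =>
      have h3 : (MonoidAlgebra.single g r : MonoidAlgebra ℂ G) = r • .single g 1 := by simp
      rw [h3, map_smul]
      simp only [Pi.smul_apply, Matrix.trace_smul, Matrix.trace_one, Fintype.card_fin, hi, hj,
        map_single_eq_one_of_degree_eq_one φ hG hnab hi,
        map_single_eq_one_of_degree_eq_one φ hG hnab hj]
  by_contra hij
  have := key (φ.symm (Pi.single i 1))
  simp [Ne.symm hij, hi] at this

theorem exists_degree_eq_one [Finite G] (hd : ∀ i, d i ≠ 0) : ∃ i, d i = 1 := by
  classical
  have := Fintype.ofFinite G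
  let e : MonoidAlgebra ℂ G := ∑ g : G, .single g 1
  have he0 : e ≠ 0 := by
    intro h
    have := congrArg (fun x : MonoidAlgebra ℂ G => x.coeff 1) h
    simp [e, Finsupp.single_apply] at this
  have he : ∀ x : MonoidAlgebra ℂ G, ∃ c : ℂ, x * e = c • e := by
    intro x
    induction x using MonoidAlgebra.induction_linear with
    | zero => exact ⟨0, by simp⟩
    | add f k hf hk =>
      obtain ⟨a, ha⟩ := hf
      obtain ⟨b, hb⟩ := hk
      exact ⟨a + b, by rw [add_mul, ha, hb, add_smul]⟩
    | single g r =>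
      refine ⟨r, ?_⟩
      simp only [e, Finset.mul_sum, MonoidAlgebra.single_mul_single, Finset.smul_sum, mul_one]
      refine Fintype.sum_equiv (Equiv.mulLeft g) _ _ fun x => ?_
      simp
  have hφe : φ e ≠ 0 := by simpa using he0
  obtain ⟨i, hi⟩ := Function.ne_iff.1 hφe
  refine ⟨i, ?_⟩
  have hM : ∀ M : Matrix (Fin (d i)) (Fin (d i)) ℂ, ∃ c : ℂ, M * φ e i = c • φ e i := by
    intro M
    obtain ⟨c, hc⟩ := he (φ.symm (Pi.single i M))
    refine ⟨c, ?_⟩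
    have := congrFun (congrArg φ hc) i
    simpa using this
  by_contra hi1
  have hi2 : 1 < d i := by have := hd i; omega
  have : Nontrivial (Fin (d i)) := Fin.nontrivial_iff_two_le.2 hi2
  obtain ⟨a, b, hab⟩ : ∃ a b, φ e i a b ≠ 0 := by
    by_contra! h
    exact hi (by ext a b; simpa using h a b)
  obtain ⟨k, hk⟩ := exists_ne a
  obtain ⟨c, hc⟩ := hM (Matrix.single k a 1)
  have h1 := congrFun (congrFun hc a) b
  rw [Matrix.single_mul_apply_of_ne (h := hk.symm)] at h1
  have hc0 : c = 0 := by simpa [hab] using h1.symm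
  have h2 := congrFun (congrFun hc k) b
  simp [hc0, hab] at h2

end TrivialBlock

section CharacterSums

variable {p : ℕ} [Fact p.Prime]

theorem sum_stdAddChar_mul (b : ZMod p) :
    ∑ a : ZMod p, ZMod.stdAddChar (a * b) = if b = 0 then (p : ℂ) else 0 := by
  have := AddChar.sum_mulShift b (ZMod.isPrimitive_stdAddChar p)
  simpa using this

theorem sum_one_sub_stdAddChar_mul (j l : ZMod p) (hj : j ≠ 0) (hl : l ≠ 0) :
    ∑ a : ZMod p, (1 - (ZMod.stdAddChar (-(j * a)) : ℂ)) * (1 - ZMod.stdAddChar (l * a)) =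
      p * (1 + if j = l then 1 else 0) := by
  have h : ∀ a : ZMod p, (1 - (ZMod.stdAddChar (-(j * a)) : ℂ)) * (1 - ZMod.stdAddChar (l * a)) =
      1 - ZMod.stdAddChar (a * (-j)) - ZMod.stdAddChar (a * l) + ZMod.stdAddChar (a * (l - j)) := by
    intro a
    have h1 : a * (l - j) = -(j * a) + l * a := by ring
    have h2 : a * (-j) = -(j * a) := by ring
    rw [h1, h2, AddChar.map_add_eq_mul, mul_comm a l]
    ring
  simp only [h, Finset.sum_add_distrib, Finset.sum_sub_distrib, sum_stdAddChar_mul]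
  simp only [neg_eq_zero, hj, hl, if_false, sub_eq_zero, eq_comm (a := l) (b := j)]
  split_ifs <;> simp
  ring

theorem Matrix.exists_trace_eq_natCast {n : Type*} [Fintype n] [DecidableEq n] {M : Matrix n n ℂ}
    (hM : IsIdempotentElem M) : ∃ m : ℕ, M.trace = m := by
  have h : IsIdempotentElem (Matrix.toLin' M) := by
    rw [IsIdempotentElem, Module.End.mul_eq_comp, ← Matrix.toLin'_mul, hM.eq]
  have := LinearMap.IsProj.trace (LinearMap.IsIdempotentElem.isProj_range _ h)
  rw [Matrix.trace_toLin'_eq] at this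
  exact ⟨_, this⟩

end CharacterSums

section CyclicSubgroup

variable {G : Type*} [Group G] {p : ℕ} [Fact p.Prime] {U : ZMod p → G}

theorem map_mul_of_map_add (hU : ∀ a b, U (a + b) = U a * U b) (a c : ZMod p) :
    U (c * a) = U a ^ c.val := by
  have h0 : U 0 = 1 := by simpa using hU 0 0
  have h : ∀ n : ℕ, U (n * a) = U a ^ n := by
    intro n
    induction n with
    | zero => simpa using h0
    | succ n ih => rw [Nat.cast_succ, add_mul, one_mul, hU, ih, pow_succ]
  rw [← h, ZMod.natCast_zmod_val]

theorem map_mul_comm_of_map_add (hU : ∀ a b, U (a + b) = U a * U b) {a s : ZMod p} {z : G}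
    (h : U a * z = z * U s) (c : ZMod p) : U (c * a) * z = z * U (c * s) := by
  have h1 : SemiconjBy z (U s) (U a) := h.symm
  rw [map_mul_of_map_add hU a c, map_mul_of_map_add hU s c]
  exact (h1.pow_right c.val).symm

theorem mul_mul_eq_self_iff (hU : ∀ a b, U (a + b) = U a * U b) (hinj : Function.Injective U)
    {s : ZMod p} {z : G} (h : U 1 * z = z * U s) (a b : ZMod p) :
    U a * z * U b = z ↔ b = -(a * s) := by
  have h0 : U 0 = 1 := by simpa using hU 0 0
  have h1 := map_mul_comm_of_map_add hU h a
  rw [mul_one] at h1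
  rw [h1, mul_assoc, ← hU, mul_eq_left, ← h0, hinj.eq_iff, add_comm, add_eq_zero_iff_eq_neg]

theorem exists_mul_eq_of_mul_mul_eq_self (hU : ∀ a b, U (a + b) = U a * U b)
    (hinj : Function.Injective U) {a b : ZMod p} {z : G} (hab : ¬ (a = 0 ∧ b = 0))
    (h : U a * z * U b = z) : ∃ s, U 1 * z = z * U s := by
  have h0 : U 0 = 1 := by simpa using hU 0 0
  have h1 : U a * z = z * U (-b) := by
    have h2 : U b * U (-b) = 1 := by rw [← hU, add_neg_cancel, h0]
    conv_rhs => rw [← h]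
    rw [mul_assoc, h2, mul_one]
  have ha : a ≠ 0 := by
    rintro rfl
    rw [h0, one_mul, mul_eq_left, ← h0, hinj.eq_iff] at h
    exact hab ⟨rfl, h⟩
  have h2 := map_mul_comm_of_map_add hU h1 a⁻¹
  rw [inv_mul_cancel₀ ha] at h2
  exact ⟨_, h2⟩

open Classical in
theorem sum_sum_one_sub_stdAddChar (hU : ∀ a b, U (a + b) = U a * U b)
    (hinj : Function.Injective U) {j l : ZMod p} (hj : j ≠ 0) (hl : l ≠ 0) (z : G) :
    ∑ a : ZMod p, ∑ b : ZMod p, (1 - (ZMod.stdAddChar (-(j * a)) : ℂ)) *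
      (1 - ZMod.stdAddChar (-(l * b))) * (if U a * z * U b = z then 1 else 0) =
      p * ((if ∃ s, U 1 * z = z * U s then 1 else 0) + if U l * z = z * U j then 1 else 0) := by
  have h0 : U 0 = 1 := by simpa using hU 0 0
  by_cases h : ∃ s, U 1 * z = z * U s
  · rw [if_pos h]
    obtain ⟨s, hs⟩ := h
    have hs0 : s ≠ 0 := by
      rintro rfl
      rw [h0, mul_one, mul_eq_right, ← h0, hinj.eq_iff] at hs
      exact one_ne_zero hs
    have h1 : U l * z = z * U j ↔ j = l * s := by
      have := map_mul_comm_of_map_add hU hs l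
      rw [mul_one] at this
      rw [this, mul_right_inj, hinj.eq_iff, eq_comm]
    simp only [mul_mul_eq_self_iff hU hinj hs, mul_ite, mul_one, mul_zero, Finset.sum_ite_eq',
      Finset.mem_univ, if_true, h1]
    rw [← sum_one_sub_stdAddChar_mul j (l * s) hj (mul_ne_zero hl hs0)]
    refine Finset.sum_congr rfl fun a _ => ?_
    rw [show -(l * -(a * s)) = l * s * a by ring]
  · have h2 : ¬ U l * z = z * U j := by
      intro hz
      have := map_mul_comm_of_map_add hU hz l⁻¹
      rw [inv_mul_cancel₀ hl] at this
      exact h ⟨_, this⟩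
    rw [if_neg h, if_neg h2]
    simp only [add_zero, mul_zero]
    refine Finset.sum_eq_zero fun a _ => Finset.sum_eq_zero fun b _ => ?_
    by_cases hz : U a * z * U b = z
    · have hab : a = 0 ∧ b = 0 := by
        by_contra hab
        exact h (exists_mul_eq_of_mul_mul_eq_self hU hinj hab hz)
      simp [hab.1]
    · simp [hz]

theorem natCard_mul_eq_mul (hU : ∀ a b, U (a + b) = U a * U b)
    (hinj : Function.Injective U) (hC : ∀ z, U 1 * z = z * U 1 → z ∈ Set.range U)
    {j l : ZMod p} (hl : l ≠ 0) (h : ∃ z, U l * z = z * U j) :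
    Nat.card {z : G // U l * z = z * U j} = p := by
  obtain ⟨z, hz⟩ := h
  have key : ∀ w, U l * w = w * U j → w * z⁻¹ ∈ Set.range U := by
    intro w hw
    refine hC _ ?_
    have h1 : U l * (w * z⁻¹) = (w * z⁻¹) * U l := by
      have h2 : U j = z⁻¹ * U l * z := by rw [mul_assoc, hz, inv_mul_cancel_left]
      rw [← mul_assoc, hw, h2]
      group
    have h3 := map_mul_comm_of_map_add hU h1 l⁻¹
    rwa [inv_mul_cancel₀ hl] at h3
  have hmem : ∀ a, U l * (U a * z) = U a * z * U j := by
    intro a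
    rw [← mul_assoc, ← hU, add_comm, hU, mul_assoc, hz, mul_assoc]
  let f : ZMod p → {z : G // U l * z = z * U j} := fun a => ⟨U a * z, hmem a⟩
  have hf : Function.Bijective f := by
    constructor
    · intro a b hab
      exact hinj (mul_right_cancel (congrArg Subtype.val hab))
    · rintro ⟨w, hw⟩
      obtain ⟨a, ha⟩ := key w hw
      exact ⟨a, Subtype.ext (by simp [f, ha])⟩
  rw [← Nat.card_congr (Equiv.ofBijective f hf), Nat.card_zmod]

end CyclicSubgroup

section CyclicIdempotent

variable {G : Type*} [Group G] {p : ℕ} [Fact p.Prime] {U : ZMod p → G}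

/-- The idempotent of the group algebra attached to the `j`-th character of a subgroup of
order `p` parametrized by `ZMod p`. -/
noncomputable def cyclicIdempotent (U : ZMod p → G) (j : ZMod p) : MonoidAlgebra ℂ G :=
  (p : ℂ)⁻¹ • ∑ a : ZMod p, (ZMod.stdAddChar (-(j * a)) : ℂ) • .single (U a) 1

theorem isIdempotentElem_cyclicIdempotent (hU : ∀ a b, U (a + b) = U a * U b) (j : ZMod p) :
    IsIdempotentElem (cyclicIdempotent U j) := by
  have hp : (p : ℂ) ≠ 0 := by exact_mod_cast (Fact.out : p.Prime).ne_zero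
  let x : ZMod p → MonoidAlgebra ℂ G := fun a =>
    (ZMod.stdAddChar (-(j * a)) : ℂ) • .single (U a) 1
  have hx : ∀ a b, x a * x b = x (a + b) := by
    intro a b
    simp only [x]
    rw [mul_add, neg_add, AddChar.map_add_eq_mul, hU, smul_mul_smul_comm,
      MonoidAlgebra.single_mul_single, one_mul]
  have hs : (∑ a, x a) * ∑ a, x a = (p : ℂ) • ∑ a, x a := by
    rw [Finset.sum_mul_sum]
    have : ∀ a : ZMod p, ∑ b, x a * x b = ∑ b, x b := by
      intro a
      simp only [hx]
      exact Fintype.sum_equiv (Equiv.addLeft a) _ _ fun b => rfl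
    simp only [this, Finset.sum_const, Finset.card_univ, ZMod.card, Nat.cast_smul_eq_nsmul]
  show ((p : ℂ)⁻¹ • ∑ a, x a) * ((p : ℂ)⁻¹ • ∑ a, x a) = (p : ℂ)⁻¹ • ∑ a, x a
  rw [smul_mul_smul_comm, hs, smul_smul, mul_assoc, inv_mul_cancel₀ hp, mul_one]

theorem sum_cyclicIdempotent (hU : ∀ a b, U (a + b) = U a * U b) :
    ∑ j, cyclicIdempotent U j = 1 := by
  have hp : (p : ℂ) ≠ 0 := by exact_mod_cast (Fact.out : p.Prime).ne_zero
  have h0 : U 0 = 1 := by simpa using hU 0 0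
  simp only [cyclicIdempotent]
  rw [← Finset.smul_sum, Finset.sum_comm]
  have : ∀ a : ZMod p, ∑ j : ZMod p, (ZMod.stdAddChar (-(j * a)) : ℂ) •
      (MonoidAlgebra.single (U a) 1 : MonoidAlgebra ℂ G) =
      if a = 0 then (p : ℂ) • MonoidAlgebra.single (U a) 1 else 0 := by
    intro a
    simp only [← mul_neg]
    rw [← Finset.sum_smul, sum_stdAddChar_mul]
    simp only [neg_eq_zero]
    split_ifs <;> simp
  simp only [this, Finset.sum_ite_eq', Finset.mem_univ, if_true, h0]
  rw [smul_smul, inv_mul_cancel₀ hp, one_smul]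
  rfl

variable {ι : Type*} {d : ι → ℕ}
  (φ : MonoidAlgebra ℂ G ≃ₐ[ℂ] ∀ i, Matrix (Fin (d i)) (Fin (d i)) ℂ)

theorem trace_map_cyclicIdempotent (i : ι) (j : ZMod p) :
    (φ (cyclicIdempotent U j) i).trace =
      (p : ℂ)⁻¹ * ∑ a, ZMod.stdAddChar (-(j * a)) * (φ (.single (U a) 1) i).trace := by
  simp only [cyclicIdempotent, map_smul, map_sum, Pi.smul_apply, Finset.sum_apply,
    Matrix.trace_smul, Matrix.trace_sum, smul_eq_mul]

variable [Finite G] [Fintype ι]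

theorem sum_degree_mul_trace_cyclicIdempotent (hU : ∀ a b, U (a + b) = U a * U b)
    (hinj : Function.Injective U) (j : ZMod p) :
    ∑ i, d i * (φ (cyclicIdempotent U j) i).trace = Nat.card G * (p : ℂ)⁻¹ := by
  have h0 : U 0 = 1 := by simpa using hU 0 0
  have h := card_mul_coeff φ (cyclicIdempotent U j) 1
  have h1 : (MonoidAlgebra.single (1 : G)⁻¹ (1 : ℂ) : MonoidAlgebra ℂ G) = 1 := by
    rw [inv_one]; rfl
  rw [h1, mul_one] at h
  rw [← h]
  congr 1
  have h2 : ∀ a : ZMod p, U a = 1 ↔ a = 0 := fun a => by rw [← h0, hinj.eq_iff]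
  classical
  simp [cyclicIdempotent, Finsupp.single_apply, h2]

open Classical in
theorem sum_trace_sub_mul_trace_sub (hU : ∀ a b, U (a + b) = U a * U b)
    (hinj : Function.Injective U) {j l : ZMod p} (hj : j ≠ 0) (hl : l ≠ 0) :
    ∑ i, ((φ (cyclicIdempotent U 0) i).trace - (φ (cyclicIdempotent U j) i).trace) *
      ((φ (cyclicIdempotent U 0) i).trace - (φ (cyclicIdempotent U l) i).trace) =
      (p : ℂ)⁻¹ * (Nat.card {z : G // ∃ s, U 1 * z = z * U s} +
        Nat.card {z : G // U l * z = z * U j}) := by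
  have hp : (p : ℂ) ≠ 0 := by exact_mod_cast (Fact.out : p.Prime).ne_zero
  have := Fintype.ofFinite G
  have hdiff : ∀ i (j : ZMod p), (φ (cyclicIdempotent U 0) i).trace -
      (φ (cyclicIdempotent U j) i).trace =
      (p : ℂ)⁻¹ * ∑ a, (1 - ZMod.stdAddChar (-(j * a))) * (φ (.single (U a) 1) i).trace := by
    intro i j
    rw [trace_map_cyclicIdempotent, trace_map_cyclicIdempotent, ← mul_sub,
      ← Finset.sum_sub_distrib]
    simp [sub_mul]
  have hterm : ∀ i, ((φ (cyclicIdempotent U 0) i).trace - (φ (cyclicIdempotent U j) i).trace) *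
      ((φ (cyclicIdempotent U 0) i).trace - (φ (cyclicIdempotent U l) i).trace) =
      (p : ℂ)⁻¹ * (p : ℂ)⁻¹ * ∑ a, ∑ b, (1 - ZMod.stdAddChar (-(j * a))) *
        (1 - ZMod.stdAddChar (-(l * b))) *
        ((φ (.single (U a) 1) i).trace * (φ (.single (U b) 1) i).trace) := by
    intro i
    rw [hdiff, hdiff, mul_mul_mul_comm, Finset.sum_mul_sum]
    congr 1
    refine Finset.sum_congr rfl fun a _ => Finset.sum_congr rfl fun b _ => ?_
    ring
  have hcard : ∀ a b : ZMod p, (Nat.card {z : G // U a * z * U b = z} : ℂ) =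
      ∑ z : G, if U a * z * U b = z then 1 else 0 := by
    intro a b
    simp [Nat.card_eq_fintype_card, Fintype.card_subtype]
  simp only [hterm]
  rw [← Finset.mul_sum, Finset.sum_comm]
  have h1 : ∀ a : ZMod p, ∑ i, ∑ b : ZMod p, (1 - (ZMod.stdAddChar (-(j * a)) : ℂ)) *
        (1 - ZMod.stdAddChar (-(l * b))) *
        ((φ (.single (U a) 1) i).trace * (φ (.single (U b) 1) i).trace) =
      ∑ z : G, ∑ b : ZMod p, (1 - (ZMod.stdAddChar (-(j * a)) : ℂ)) *
        (1 - ZMod.stdAddChar (-(l * b))) * (if U a * z * U b = z then 1 else 0) := by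
    intro a
    rw [Finset.sum_comm, Finset.sum_comm (s := Finset.univ (α := G))]
    refine Finset.sum_congr rfl fun b _ => ?_
    rw [← Finset.mul_sum, sum_trace_mul_trace_single, hcard, Finset.mul_sum]
  simp only [h1]
  rw [Finset.sum_comm]
  simp only [sum_sum_one_sub_stdAddChar hU hinj hj hl]
  rw [← Finset.mul_sum, Finset.sum_add_distrib]
  simp only [Nat.card_eq_fintype_card, Fintype.card_subtype]
  simp only [Finset.sum_boole]
  field_simp

end CyclicIdempotent

section Data

open Classical in
theorem exists_degrees_and_multiplicities {G : Type*} [Group G] [Finite G]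
    (hG : IsSimpleGroup G) (hnab : ¬ ∀ a b : G, a * b = b * a)
    {p : ℕ} [Fact p.Prime] {U : ZMod p → G} (hU : ∀ a b, U (a + b) = U a * U b)
    (hinj : Function.Injective U) (hC : ∀ z, U 1 * z = z * U 1 → z ∈ Set.range U) {e : ℕ}
    (he : Nat.card {z : G // ∃ s, U 1 * z = z * U s} = p * e) :
    ∃ (k : ℕ) (n : Fin k → ℕ) (a : Fin k → ZMod p → ℤ) (i₀ : Fin k),
      (∀ i, n i ∣ Nat.card G) ∧ n i₀ = 1 ∧ (∀ i, i ≠ i₀ → n i ≠ 1) ∧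
      (∀ j, j ≠ 0 → a i₀ j = 1) ∧ (∀ j, ∑ i, a i j * n i = 0) ∧
      (∀ i, (p : ℤ) ∣ n i + ∑ j, a i j) ∧ (∀ i, a i 0 = 0) ∧
      ∀ j l, j ≠ 0 → l ≠ 0 →
        ∑ i, a i j * a i l = e + if ∃ z, U l * z = z * U j then 1 else 0 := by
  have hp : (p : ℂ) ≠ 0 := by exact_mod_cast (Fact.out : p.Prime).ne_zero
  obtain ⟨k, d, hd, ⟨φ⟩⟩ :=
    IsSemisimpleRing.exists_algEquiv_pi_matrix_of_isAlgClosed ℂ (MonoidAlgebra ℂ G)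
  have hd0 : ∀ i, d i ≠ 0 := fun i => (hd i).ne
  obtain ⟨i₀, hi₀⟩ := exists_degree_eq_one φ hd0
  have hb : ∀ i (j : ZMod p), ∃ m : ℕ, (φ (cyclicIdempotent U j) i).trace = m := by
    intro i j
    refine Matrix.exists_trace_eq_natCast ?_
    have h := (isIdempotentElem_cyclicIdempotent hU j).map φ
    exact congrFun h i
  choose b hb using hb
  have hsum : ∀ i, ∑ j, b i j = d i := by
    intro i
    have h := congrArg (fun x => (φ x i).trace) (sum_cyclicIdempotent hU)
    simp only [map_sum, Finset.sum_apply, Matrix.trace_sum, hb, map_one, Pi.one_apply,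
      Matrix.trace_one, Fintype.card_fin] at h
    exact_mod_cast h
  refine ⟨k, d, fun i j => b i 0 - b i j, i₀, fun i => degree_dvd_card φ i (hd0 i), hi₀,
    fun i hi h => hi (degree_eq_one_unique φ hG hnab h hi₀), ?_, ?_, ?_, ?_, ?_⟩
  · intro j hj
    have h : ∀ j : ZMod p, (b i₀ j : ℂ) = if j = 0 then 1 else 0 := by
      intro j
      rw [← hb, trace_map_cyclicIdempotent]
      simp only [map_single_eq_one_of_degree_eq_one φ hG hnab hi₀, Matrix.trace_one,
        Fintype.card_fin, hi₀, Nat.cast_one, mul_one]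
      have := sum_stdAddChar_mul (-j)
      simp only [mul_neg, neg_eq_zero, mul_comm _ j] at this
      rw [this]
      split_ifs <;> simp [hp]
    have h0 := h 0
    have h1 := h j
    rw [if_pos rfl] at h0
    rw [if_neg hj] at h1
    have h0' : b i₀ 0 = 1 := by exact_mod_cast h0
    have h1' : b i₀ j = 0 := by exact_mod_cast h1
    simp [h0', h1']
  · intro j
    have h0 := sum_degree_mul_trace_cyclicIdempotent φ hU hinj 0
    rw [← sum_degree_mul_trace_cyclicIdempotent φ hU hinj j, ← sub_eq_zero,
      ← Finset.sum_sub_distrib] at h0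
    simp only [hb] at h0
    have : ((∑ i, ((b i 0 : ℤ) - b i j) * d i : ℤ) : ℂ) = 0 := by
      push_cast
      rw [← h0]
      exact Finset.sum_congr rfl fun i _ => by ring
    exact_mod_cast this
  · intro i
    rw [Finset.sum_sub_distrib, ← hsum]
    simp
  · intro i
    simp
  · intro j l hj hl
    have h := sum_trace_sub_mul_trace_sub φ hU hinj hj hl
    have h1 : Nat.card {z : G // U l * z = z * U j} =
        p * if ∃ z, U l * z = z * U j then 1 else 0 := by
      split_ifs with hz
      · rw [natCard_mul_eq_mul hU hinj hC hl hz, mul_one]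
      · rw [mul_zero]
        have : IsEmpty {z : G // U l * z = z * U j} := ⟨fun z => hz ⟨z.1, z.2⟩⟩
        exact Nat.card_of_isEmpty
    rw [he, h1] at h
    simp only [hb, Nat.cast_mul, ← mul_add, inv_mul_cancel_left₀ hp] at h
    exact_mod_cast h

end Data

section GramRelations

open Classical in
theorem nonpos_of_sum_sq_eq_two {ι : Type*} [Fintype ι] {n : ι → ℕ} (hn : ∀ i, 0 < n i)
    {x : ι → ℤ} (hx : ∑ i, x i ^ 2 = 2) (h0 : ∑ i, x i * n i = 0) {i j : ι} (hi : x i = 1)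
    (hij : j ≠ i) : x j ≤ 0 := by
  by_contra! hj
  obtain ⟨l, hl⟩ : ∃ l, x l < 0 := by
    by_contra! h
    have h1 : x i * n i ≤ ∑ i, x i * n i :=
      Finset.single_le_sum (f := fun i => x i * (n i : ℤ))
        (fun l _ => mul_nonneg (h l) (by positivity)) (Finset.mem_univ i)
    rw [h0, hi, one_mul] at h1
    have := hn i
    omega
  have hli : l ≠ i := by rintro rfl; omega
  have hlj : l ≠ j := by rintro rfl; omega
  have h1 : ∑ m ∈ ({i, j, l} : Finset ι), x m ^ 2 ≤ ∑ m, x m ^ 2 :=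
    Finset.sum_le_sum_of_subset_of_nonneg (Finset.subset_univ _) fun m _ _ => sq_nonneg _
  rw [Finset.sum_insert (by simp [hij.symm, hli.symm]), Finset.sum_insert (by simp [hlj.symm]),
    Finset.sum_singleton, hx] at h1
  nlinarith

variable {ι X : Type*} [Fintype ι] {n : ι → ℕ} {a : ι → X → ℤ} {R : X → X → Prop} {e : ℤ}

open Classical in
theorem sum_sub_mul_sub
    (hg : ∀ j l, ∑ i, a i j * a i l = e + if R j l then 1 else 0) (j l j' l' : X) :
    ∑ i, (a i j - a i l) * (a i j' - a i l') = (if R j j' then 1 else 0) -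
      (if R j l' then 1 else 0) - (if R l j' then 1 else 0) + if R l l' then 1 else 0 := by
  have : ∀ i, (a i j - a i l) * (a i j' - a i l') =
      a i j * a i j' - a i j * a i l' - a i l * a i j' + a i l * a i l' := fun i => by ring
  simp only [this, Finset.sum_add_distrib, Finset.sum_sub_distrib, hg]
  ring

open Classical in
theorem eq_of_rel (hR : Equivalence R)
    (hg : ∀ j l, ∑ i, a i j * a i l = e + if R j l then 1 else 0) {j l : X} (h : R j l) (i : ι) :
    a i j = a i l := by
  have h1 := sum_sub_mul_sub hg j l j l
  rw [if_pos (hR.refl j), if_pos h, if_pos (hR.symm h), if_pos (hR.refl l)] at h1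
  have h2 := (Finset.sum_eq_zero_iff_of_nonneg fun i _ => mul_self_nonneg _).1 h1 i
    (Finset.mem_univ i)
  linarith [mul_self_eq_zero.1 h2]

open Classical in
theorem sum_sub_sq_eq_two (hR : Equivalence R)
    (hg : ∀ j l, ∑ i, a i j * a i l = e + if R j l then 1 else 0) {j l : X} (h : ¬ R j l) :
    ∑ i, (a i j - a i l) ^ 2 = 2 := by
  have h1 := sum_sub_mul_sub hg j l j l
  rw [if_pos (hR.refl j), if_neg h, if_neg (fun h' => h (hR.symm h')), if_pos (hR.refl l)] at h1
  simp only [sq]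
  rw [h1]
  norm_num

open Classical in
theorem sub_le_one (hR : Equivalence R)
    (hg : ∀ j l, ∑ i, a i j * a i l = e + if R j l then 1 else 0) (j l : X) (i : ι) :
    a i j - a i l ≤ 1 := by
  by_cases h : R j l
  · rw [eq_of_rel hR hg h]; simp
  · have h1 := sum_sub_sq_eq_two hR hg h
    have h2 := Finset.single_le_sum (f := fun i => (a i j - a i l) ^ 2)
      (fun i _ => sq_nonneg _) (Finset.mem_univ i)
    simp only [h1] at h2
    nlinarith

open Classical in
theorem rel_or_rel_of_sub_eq_one (hR : Equivalence R) (hn : ∀ i, 0 < n i)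
    (h0 : ∀ j, ∑ i, a i j * n i = 0)
    (hg : ∀ j l, ∑ i, a i j * a i l = e + if R j l then 1 else 0) {j l j' l' : X} {i : ι}
    (h : a i j - a i l = 1) (h' : a i j' - a i l' = 1) (hjl' : a i j - a i l' = 1)
    (hj'l : a i j' - a i l = 1) : R j j' ∨ R l l' := by
  by_contra! hc
  have hne : ∀ {x y}, a i x - a i y = 1 → ¬ R x y := fun hxy hr => by
    rw [eq_of_rel hR hg hr] at hxy; omega
  have key : ∀ {x y}, a i x - a i y = 1 → ∀ m, m ≠ i → a m x - a m y ≤ 0 := by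
    intro x y hxy m hm
    refine nonpos_of_sum_sq_eq_two hn (x := fun i => a i x - a i y)
      (sum_sub_sq_eq_two hR hg (hne hxy)) ?_ hxy hm
    simp only [sub_mul, Finset.sum_sub_distrib, h0, sub_zero]
  have h1 := sum_sub_mul_sub hg j l j' l'
  rw [if_neg hc.1, if_neg (hne hjl'), if_neg (fun hr => hne hj'l (hR.symm hr)), if_neg hc.2] at h1
  have h2 := Finset.single_le_sum (f := fun m => (a m j - a m l) * (a m j' - a m l'))
    (fun m _ => by
      by_cases hm : m = i
      · subst hm; rw [h, h']; norm_num
      · exact mul_nonneg_of_nonpos_of_nonpos (key h m hm) (key h' m hm)) (Finset.mem_univ i)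
  simp only [h1, h, h'] at h2
  omega

open Classical in
theorem exists_const_off_class [Finite X] [Nonempty X] (hR : Equivalence R) (hn : ∀ i, 0 < n i)
    (h0 : ∀ j, ∑ i, a i j * n i = 0)
    (hg : ∀ j l, ∑ i, a i j * a i l = e + if R j l then 1 else 0) (i : ι) :
    ∃ (c δ : ℤ) (j₀ : X), (δ = -1 ∨ δ = 0 ∨ δ = 1) ∧
      ∀ j, a i j = c + if R j₀ j then δ else 0 := by
  obtain ⟨j₁, hj₁⟩ := Finite.exists_min (a i)
  have hval : ∀ j, a i j = a i j₁ ∨ a i j = a i j₁ + 1 := by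
    intro j
    have h1 := hj₁ j
    have h2 := sub_le_one hR hg j j₁ i
    omega
  by_cases htop : ∃ j j', ¬ R j j' ∧ a i j = a i j₁ + 1 ∧ a i j' = a i j₁ + 1
  · obtain ⟨j, j', hjj', hj, hj'⟩ := htop
    refine ⟨a i j₁ + 1, -1, j₁, Or.inl rfl, fun l => ?_⟩
    split_ifs with hl
    · rw [eq_of_rel hR hg hl]; ring
    · rcases hval l with h | h
      · rcases rel_or_rel_of_sub_eq_one hR hn h0 hg (i := i) (j := j) (j' := j') (l := j₁) (l' := l)
          (by omega) (by omega) (by omega) (by omega) with h' | h'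
        · exact absurd h' hjj'
        · exact absurd h' hl
      · omega
  · push Not at htop
    by_cases hex : ∃ j, a i j = a i j₁ + 1
    · obtain ⟨j, hj⟩ := hex
      refine ⟨a i j₁, 1, j, Or.inr (Or.inr rfl), fun l => ?_⟩
      split_ifs with hl
      · rw [← eq_of_rel hR hg hl, hj]
      · have := htop j l hl hj
        have := hval l
        omega
    · push Not at hex
      refine ⟨a i j₁, 0, j₁, Or.inr (Or.inl rfl), fun l => ?_⟩
      have h1 := hex l
      have h2 := hval l
      split_ifs <;> omega

end GramRelations

section Arithmetic

theorem exists_residue_of_sq_eq_one {p e c δ v : ℤ} {n : ℕ} (hc : c ^ 2 ≤ 3)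
    (hcδ : (c + δ) ^ 2 ≤ 3) (hδ : δ = -1 ∨ δ = 0 ∨ δ = 1) (hv : v = c ∨ v = c + δ) (hv1 : v ^ 2 = 1)
    (hp : p ∣ n - c + e * δ) : p ∣ v * n - 1 ∨ p ∣ v * n - (1 + e) ∨ p ∣ v * n + e := by
  have h1 : c = -1 ∨ c = 0 ∨ c = 1 := by
    have h2 : c < 2 := by nlinarith
    have h3 : -2 < c := by nlinarith
    omega
  have h4 : v = -1 ∨ v = 1 := by
    rcases mul_self_eq_one_iff.1 ((sq v).symm.trans hv1) with h | h <;> simp [h]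
  obtain ⟨t, ht⟩ := hp
  have hn : (n : ℤ) = p * t + c - e * δ := by linarith
  rw [hn]
  rcases h4 with rfl | rfl <;> rcases h1 with rfl | rfl | rfl <;> rcases hδ with rfl | rfl | rfl <;>
    first
    | (exfalso; omega)
    | (exfalso; norm_num at hcδ; done)
    | exact Or.inl ⟨t, by ring1⟩
    | exact Or.inl ⟨-t, by ring1⟩
    | exact Or.inr (Or.inl ⟨t, by ring1⟩)
    | exact Or.inr (Or.inl ⟨-t, by ring1⟩)
    | exact Or.inr (Or.inr ⟨t, by ring1⟩)
    | exact Or.inr (Or.inr ⟨-t, by ring1⟩)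

theorem dvd_576_of_not_dvd {p n : ℕ} (hp : p.Prime) (hn : n ∣ 576 * p) (h : ¬ p ∣ n) : n ∣ 576 :=
  ((hp.coprime_iff_not_dvd.2 h).symm).dvd_of_dvd_mul_right hn

theorem le_nine_of_add_eq_neg_one {m n : ℕ} (hm : m ∣ 576) (hn : n ∣ 576) (hm1 : m ≠ 1)
    (hn1 : n ≠ 1) {v w : ℤ} (hv : v ^ 2 = 1) (hw : w ^ 2 = 1) (h : v * m + w * n = -1) :
    m ≤ 9 ∧ n ≤ 9 := by
  have key : ∀ m ∈ Nat.divisors 576, ∀ n ∈ Nat.divisors 576, m ≠ 1 → n ≠ 1 →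
      (m = n + 1 ∨ n = m + 1) → m ≤ 9 ∧ n ≤ 9 := by decide +kernel
  refine key m (Nat.mem_divisors.2 ⟨hm, by norm_num⟩) n (Nat.mem_divisors.2 ⟨hn, by norm_num⟩)
    hm1 hn1 ?_
  have hm0 := Nat.pos_of_dvd_of_pos hm (by norm_num)
  have hn0 := Nat.pos_of_dvd_of_pos hn (by norm_num)
  rcases mul_self_eq_one_iff.1 ((sq v).symm.trans hv) with rfl | rfl <;>
    rcases mul_self_eq_one_iff.1 ((sq w).symm.trans hw) with rfl | rfl <;> omega

theorem mem_of_dvd_576_of_residue {p : ℕ} (hp : p = 19 ∨ p = 31) {n : ℕ} (hn : n ∣ 576)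
    (hn1 : n ≠ 1) {v : ℤ} (hv : v ^ 2 = 1)
    (h : (p : ℤ) ∣ v * n - 1 ∨ (p : ℤ) ∣ v * n - (1 + 3) ∨ (p : ℤ) ∣ v * n + 3) :
    (p = 19 → v * n ∈ [-18, 96, 16, -3, -288, 4, -72]) ∧ (p = 31 → v * n ∈ [32, -3, -96, 4]) := by
  have key : ∀ n ∈ Nat.divisors 576, ∀ v ∈ [(1 : ℤ), -1], n ≠ 1 →
      ((19 : ℤ) ∣ v * n - 1 ∨ (19 : ℤ) ∣ v * n - (1 + 3) ∨ (19 : ℤ) ∣ v * n + 3 →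
        v * n ∈ [-18, 96, 16, -3, -288, 4, -72]) ∧
      ((31 : ℤ) ∣ v * n - 1 ∨ (31 : ℤ) ∣ v * n - (1 + 3) ∨ (31 : ℤ) ∣ v * n + 3 →
        v * n ∈ [32, -3, -96, 4]) := by decide +kernel
  have hv' : v ∈ [(1 : ℤ), -1] := by
    rcases mul_self_eq_one_iff.1 ((sq v).symm.trans hv) with rfl | rfl <;> simp
  have h2 := key n (Nat.mem_divisors.2 ⟨hn, by norm_num⟩) v hv' hn1
  constructor
  · rintro rfl; exact h2.1 (by exact_mod_cast h)
  · rintro rfl; exact h2.2 (by exact_mod_cast h)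

theorem odd_dvd_false {p : ℕ} (hp : p = 19 ∨ p = 31) {n : ℕ} (hn : n ∣ 576 * p) (hn1 : n ≠ 1)
    (hodd : Odd n) {c δ : ℤ} (hc : c ^ 2 ≤ 6) (hcδ : (c + δ) ^ 2 ≤ 6)
    (hδ : δ = -1 ∨ δ = 0 ∨ δ = 1) (h : (p : ℤ) ∣ n - c + 6 * δ) : c = 0 ∧ δ = 0 := by
  have h2 : c ≤ 2 := by nlinarith
  have h3 : -2 ≤ c := by nlinarith
  have h4 : c + δ ≤ 2 := by nlinarith
  have h5 : -2 ≤ c + δ := by nlinarith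
  have hcop : Nat.Coprime n 64 := by
    rw [show 64 = 2 ^ 6 by norm_num]
    exact (Nat.coprime_two_right.2 hodd).pow_right 6
  have hn9 : n ∣ 9 * p := by
    refine hcop.dvd_of_dvd_mul_left ?_
    rw [← mul_assoc]; exact hn
  by_cases hpn : p ∣ n
  · have hpn' : (p : ℤ) ∣ n := by exact_mod_cast hpn
    have h6 : (p : ℤ) ∣ -c + 6 * δ := by
      have := dvd_sub h hpn'
      rwa [show (n : ℤ) - c + 6 * δ - n = -c + 6 * δ by ring] at this
    rcases hp with rfl | rfl <;> omega
  · have hpp : p.Prime := by rcases hp with rfl | rfl <;> norm_num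
    have h9 : n ∣ 9 := ((hpp.coprime_iff_not_dvd.2 hpn).symm).dvd_of_dvd_mul_right hn9
    have h10 : n = 3 ∨ n = 9 := by
      have : n ≤ 9 := Nat.le_of_dvd (by norm_num) h9
      interval_cases n <;> omega
    rcases h10 with rfl | rfl <;> rcases hp with rfl | rfl <;> omega

end Arithmetic

section Contradiction

open Classical in
theorem sum_ite_rel {X : Type*} [Fintype X] {R : X → X → Prop} {e : ℕ}
    (hclass : ∀ j, Nat.card {l // R j l} = e) (j : X) (δ : ℤ) :
    ∑ l, (if R j l then δ else 0) = e * δ := by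
  rw [← hclass j, Finset.sum_ite, Finset.sum_const_zero, add_zero, Finset.sum_const,
    Nat.card_eq_fintype_card, Fintype.card_subtype, nsmul_eq_mul]

variable {ι X : Type*} [Fintype ι] {p e : ℕ} {n : ι → ℕ} {a : ι → X → ℤ}
  {R : X → X → Prop} {i₀ : ι}

open Classical in
theorem sum_erase_sq (hR : Equivalence R) (ha₀ : ∀ j, a i₀ j = 1)
    (hg : ∀ j l, ∑ i, a i j * a i l = e + if R j l then 1 else 0) (j : X) :
    ∑ i ∈ Finset.univ.erase i₀, a i j ^ 2 = e := by
  have h := hg j j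
  rw [if_pos (hR.refl j), ← Finset.add_sum_erase _ _ (Finset.mem_univ i₀), ha₀] at h
  simp only [sq]
  linarith

open Classical in
theorem sq_le_of_ne (hR : Equivalence R) (ha₀ : ∀ j, a i₀ j = 1)
    (hg : ∀ j l, ∑ i, a i j * a i l = e + if R j l then 1 else 0) (j : X) {i : ι} (hi : i ≠ i₀) :
    a i j ^ 2 ≤ e := by
  rw [← sum_erase_sq hR ha₀ hg j]
  exact Finset.single_le_sum (f := fun i => a i j ^ 2) (fun i _ => sq_nonneg _)
    (Finset.mem_erase.2 ⟨hi, Finset.mem_univ i⟩)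

variable [Fintype X]

open Classical in
theorem exists_const_residue (hR : Equivalence R) (hX : Fintype.card X + 1 = p) (hep : e + 1 < p)
    (hclass : ∀ j, Nat.card {l // R j l} = e) (hn : ∀ i, 0 < n i) (ha₀ : ∀ j, a i₀ j = 1)
    (h0 : ∀ j, ∑ i, a i j * n i = 0) (hsum : ∀ i, (p : ℤ) ∣ n i + ∑ j, a i j)
    (hg : ∀ j l, ∑ i, a i j * a i l = e + if R j l then 1 else 0) {i : ι} (hi : i ≠ i₀) :
    ∃ c δ : ℤ, (δ = -1 ∨ δ = 0 ∨ δ = 1) ∧ (∀ j, a i j = c ∨ a i j = c + δ) ∧ c ^ 2 ≤ e ∧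
      (c + δ) ^ 2 ≤ e ∧ (p : ℤ) ∣ n i - c + e * δ := by
  have : Nonempty X := Fintype.card_pos_iff.1 (by omega)
  obtain ⟨c, δ, j₀, hδ, ha⟩ := exists_const_off_class hR hn h0 hg i
  refine ⟨c, δ, hδ, fun j => ?_, ?_, ?_, ?_⟩
  · rw [ha]
    split_ifs
    · exact Or.inr rfl
    · exact Or.inl (add_zero c)
  · obtain ⟨j, hj⟩ : ∃ j, ¬ R j₀ j := by
      by_contra! h
      have h1 := hclass j₀
      rw [Nat.card_eq_fintype_card, Fintype.card_subtype, Finset.filter_true_of_mem (by simp [h]),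
        Finset.card_univ] at h1
      omega
    have h1 := sq_le_of_ne hR ha₀ hg j hi
    rwa [ha, if_neg hj, add_zero] at h1
  · have h1 := sq_le_of_ne hR ha₀ hg j₀ hi
    rwa [ha, if_pos (hR.refl j₀)] at h1
  · have h1 := hsum i
    simp only [ha, Finset.sum_add_distrib, sum_ite_rel hclass, Finset.sum_const,
      Finset.card_univ, nsmul_eq_mul] at h1
    have h2 : (Fintype.card X : ℤ) = p - 1 := by omega
    rw [h2] at h1
    have h3 := dvd_sub h1 (dvd_mul_right (p : ℤ) c)
    rwa [show (n i : ℤ) + ((p - 1) * c + e * δ) - p * c = n i - c + e * δ by ring] at h3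

open Classical in
theorem false_of_degrees_and_multiplicities (hp : p.Prime) (hp19 : 19 ≤ p) (hR : Equivalence R)
    (hX : Fintype.card X + 1 = p) (hclass : ∀ j, Nat.card {l // R j l} = e)
    (hdvd : ∀ i, n i ∣ 576 * p) (hn₀ : n i₀ = 1) (hn1 : ∀ i, i ≠ i₀ → n i ≠ 1)
    (ha₀ : ∀ j, a i₀ j = 1) (h0 : ∀ j, ∑ i, a i j * n i = 0)
    (hsum : ∀ i, (p : ℤ) ∣ n i + ∑ j, a i j)
    (hg : ∀ j l, ∑ i, a i j * a i l = e + if R j l then 1 else 0)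
    (he : e = 1 ∨ e = 2 ∨ (e = 3 ∨ e = 6) ∧ (p = 19 ∨ p = 31)) : False := by
  have hn : ∀ i, 0 < n i := fun i => Nat.pos_of_dvd_of_pos (hdvd i) (by positivity)
  have hep : e + 1 < p := by omega
  have hres := fun i (hi : i ≠ i₀) =>
    exists_const_residue (i := i) hR hX hep hclass hn ha₀ h0 hsum hg hi
  obtain ⟨j⟩ : Nonempty X := Fintype.card_pos_iff.1 (by omega)
  have hsq := sum_erase_sq hR ha₀ hg j
  have hdeg : ∑ i ∈ Finset.univ.erase i₀, a i j * n i = -1 := by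
    have h := h0 j
    rw [← Finset.add_sum_erase _ _ (Finset.mem_univ i₀), ha₀, hn₀] at h
    push_cast at h
    linarith
  by_cases he6 : e = 6
  · subst he6
    have hp' : p = 19 ∨ p = 31 := by omega
    obtain ⟨i, hi, hodd⟩ : ∃ i ∈ Finset.univ.erase i₀, Odd (a i j * n i) := by
      by_contra! h
      have h1 : (2 : ℤ) ∣ ∑ i ∈ Finset.univ.erase i₀, a i j * n i :=
        Finset.dvd_sum fun i hi => (Int.not_odd_iff_even.1 (h i hi)).two_dvd
      rw [hdeg] at h1
      omega
    have hi' := Finset.ne_of_mem_erase hi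
    rw [Int.odd_mul] at hodd
    obtain ⟨c, δ, hδ, ha, hc, hcδ, hpd⟩ := hres i hi'
    obtain ⟨rfl, rfl⟩ := odd_dvd_false hp' (hdvd i) (hn1 i hi') (by exact_mod_cast hodd.2) hc hcδ
      hδ hpd
    have : a i j = 0 := by simpa using ha j
    rw [this] at hodd
    exact absurd hodd.1 (by decide)
  have he3 : e ≤ 3 := by omega
  let S : Finset ι := (Finset.univ.erase i₀).filter fun i => a i j ≠ 0
  have hS : ∀ i ∈ S, i ≠ i₀ ∧ a i j ^ 2 = 1 ∧ n i ∣ 576 ∧ n i ≠ 1 ∧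
      ((p : ℤ) ∣ a i j * n i - 1 ∨ (p : ℤ) ∣ a i j * n i - (1 + e) ∨
        (p : ℤ) ∣ a i j * n i + e) := by
    intro i hi
    obtain ⟨hi1, hi2⟩ := Finset.mem_filter.1 hi
    have hi' := Finset.ne_of_mem_erase hi1
    have h1 : a i j ^ 2 = 1 := by
      have h2 := sq_le_of_ne hR ha₀ hg j hi'
      have h3 : a i j < 2 := by nlinarith
      have h4 : -2 < a i j := by nlinarith
      have h5 : a i j = 1 ∨ a i j = -1 := by omega
      rcases h5 with h5 | h5 <;> rw [h5] <;> norm_num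
    obtain ⟨c, δ, hδ, ha, hc, hcδ, hpd⟩ := hres i hi'
    have h6 := exists_residue_of_sq_eq_one (p := p) (e := e) (n := n i) (by omega) (by omega) hδ
      (ha j) h1 hpd
    refine ⟨hi', h1, dvd_576_of_not_dvd hp (hdvd i) fun hpn => ?_, hn1 i hi', h6⟩
    have h7 : (p : ℤ) ∣ a i j * n i := Dvd.dvd.mul_left (by exact_mod_cast hpn) _
    have hsmall : ∀ r : ℤ, 0 < r → r < p → ¬ (p : ℤ) ∣ r := fun r hr hrp hd =>
      absurd (Int.le_of_dvd hr hd) (by omega)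
    rcases h6 with h | h | h
    · exact hsmall 1 (by norm_num) (by omega) ((dvd_sub_right h7).1 h)
    · exact hsmall (1 + e) (by omega) (by omega) ((dvd_sub_right h7).1 h)
    · exact hsmall e (by omega) (by omega) ((dvd_add_right h7).1 h)
  have hcard : S.card = e := by
    have h1 : ∑ i ∈ S, a i j ^ 2 = e := by
      rw [← hsq]
      refine Finset.sum_subset (Finset.filter_subset _ _) fun i hi hiS => ?_
      have : a i j = 0 := by
        by_contra h
        exact hiS (Finset.mem_filter.2 ⟨hi, h⟩)
      rw [this]; rfl
    rw [Finset.sum_congr rfl fun i hi => (hS i hi).2.1] at h1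
    simpa using h1
  have hdegS : ∑ i ∈ S, a i j * n i = -1 := by
    rw [← hdeg]
    refine Finset.sum_subset (Finset.filter_subset _ _) fun i hi hiS => ?_
    have : a i j = 0 := by
      by_contra h
      exact hiS (Finset.mem_filter.2 ⟨hi, h⟩)
    rw [this, zero_mul]
  have habs : ∀ {v : ℤ} {m : ℕ}, v ^ 2 = 1 → v * m = m ∨ v * m = -m := fun {v m} hv => by
    rcases mul_self_eq_one_iff.1 ((sq v).symm.trans hv) with rfl | rfl <;> simp
  have heq : ∀ x y : ℤ, (p : ℤ) ∣ x - y → -19 < x - y → x - y < 19 → x = y := fun x y h h1 h2 => by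
    have h3 := Int.eq_zero_of_abs_lt_dvd h (abs_lt.2 ⟨by omega, by omega⟩)
    omega
  obtain rfl | rfl | ⟨rfl, hp'⟩ : e = 1 ∨ e = 2 ∨ e = 3 ∧ (p = 19 ∨ p = 31) := by omega
  · obtain ⟨x, hx⟩ := Finset.card_eq_one.1 hcard
    obtain ⟨-, h1, -, h3, -⟩ := hS x (by simp [hx])
    rw [hx, Finset.sum_singleton] at hdegS
    rcases habs (m := n x) h1 with h | h <;> omega
  · obtain ⟨x, y, hxy, hS2⟩ := Finset.card_eq_two.1 hcard
    obtain ⟨-, hx1, hx2, hx3, hx4⟩ := hS x (by simp [hS2])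
    obtain ⟨-, hy1, hy2, hy3, hy4⟩ := hS y (by simp [hS2])
    rw [hS2, Finset.sum_pair hxy] at hdegS
    obtain ⟨hx9, hy9⟩ := le_nine_of_add_eq_neg_one hx2 hy2 hx3 hy3 hx1 hy1 hdegS
    have key : ∀ {v : ℤ} {m : ℕ}, v ^ 2 = 1 → m ≠ 1 → m ≤ 9 →
        ((p : ℤ) ∣ v * m - 1 ∨ (p : ℤ) ∣ v * m - (1 + (2 : ℕ)) ∨ (p : ℤ) ∣ v * m + (2 : ℕ)) →
        v * m = 3 ∨ v * m = -2 := fun {v m} hv hm hm9 h => by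
      have hb := habs (m := m) hv
      rcases h with h | h | h
      · have := heq _ _ h (by omega) (by omega)
        omega
      · have := heq _ _ h (by push_cast; omega) (by push_cast; omega)
        push_cast at this
        omega
      · rw [← sub_neg_eq_add] at h
        have := heq _ _ h (by push_cast; omega) (by push_cast; omega)
        push_cast at this
        omega
    have h1 := key hx1 hx3 hx9 hx4
    have h2 := key hy1 hy3 hy9 hy4
    omega
  · obtain ⟨x, y, z, hxy, hxz, hyz, hS3⟩ := Finset.card_eq_three.1 hcard
    obtain ⟨-, hx1, hx2, hx3, hx4⟩ := hS x (by simp [hS3])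
    obtain ⟨-, hy1, hy2, hy3, hy4⟩ := hS y (by simp [hS3])
    obtain ⟨-, hz1, hz2, hz3, hz4⟩ := hS z (by simp [hS3])
    rw [hS3, Finset.sum_insert (by simp [hxy, hxz]), Finset.sum_pair hyz] at hdegS
    have hx := mem_of_dvd_576_of_residue hp' hx2 hx3 hx1 (by exact_mod_cast hx4)
    have hy := mem_of_dvd_576_of_residue hp' hy2 hy3 hy1 (by exact_mod_cast hy4)
    have hz := mem_of_dvd_576_of_residue hp' hz2 hz3 hz1 (by exact_mod_cast hz4)
    have h19 : ∀ x ∈ ([-18, 96, 16, -3, -288, 4, -72] : List ℤ),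
        ∀ y ∈ ([-18, 96, 16, -3, -288, 4, -72] : List ℤ),
        ∀ z ∈ ([-18, 96, 16, -3, -288, 4, -72] : List ℤ), x + (y + z) ≠ -1 := by decide +kernel
    have h31 : ∀ x ∈ ([32, -3, -96, 4] : List ℤ), ∀ y ∈ ([32, -3, -96, 4] : List ℤ),
        ∀ z ∈ ([32, -3, -96, 4] : List ℤ), x + (y + z) ≠ -1 := by decide +kernel
    rcases hp' with h | h
    · exact h19 _ (hx.1 h) _ (hy.1 h) _ (hz.1 h) hdegS
    · exact h31 _ (hx.2 h) _ (hy.2 h) _ (hz.2 h) hdegS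

end Contradiction

section SelfCentralizing

variable {G : Type*} [Group G] {p : ℕ} [Fact p.Prime] {U : ZMod p → G}

theorem equivalence_exists_mul_eq_mul {G X : Type*} [Group G] (U : X → G) :
    Equivalence fun j l => ∃ z, U l * z = z * U j where
  refl j := ⟨1, by simp⟩
  symm := by
    rintro j l ⟨z, hz⟩
    exact ⟨z⁻¹, by rw [eq_inv_mul_iff_mul_eq, ← mul_assoc, ← hz, mul_inv_cancel_right]⟩
  trans := by
    rintro j l m ⟨z, hz⟩ ⟨w, hw⟩
    exact ⟨w * z, by rw [← mul_assoc, hw, mul_assoc, hz, mul_assoc]⟩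

theorem dvd_card_of_equivalence {X : Type*} [Finite X] {R : X → X → Prop} (hR : Equivalence R)
    {e : ℕ} (h : ∀ j, Nat.card {l // R j l} = e) : e ∣ Nat.card X := by
  let s : Setoid X := ⟨R, hR⟩
  have := Fintype.ofFinite (Quotient s)
  rw [← Nat.card_congr (Equiv.sigmaFiberEquiv (Quotient.mk s)), Nat.card_sigma]
  refine Finset.dvd_sum fun q _ => ?_
  induction q using Quotient.inductionOn with
  | h j =>
    rw [← h j]
    refine (Nat.card_congr (Equiv.subtypeEquivRight fun l => ?_)).dvd
    rw [Quotient.eq]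
    exact ⟨hR.symm, hR.symm⟩

theorem card_class_eq [Finite G] (hU : ∀ a b, U (a + b) = U a * U b)
    (hinj : Function.Injective U) (hC : ∀ z, U 1 * z = z * U 1 → z ∈ Set.range U) {e : ℕ}
    (he : Nat.card {z : G // ∃ s, U 1 * z = z * U s} = p * e) (j : (ZMod p)ˣ) :
    Nat.card {l : (ZMod p)ˣ // ∃ z, U l * z = z * U j} = e := by
  have hp : 0 < p := (Fact.out : p.Prime).pos
  have h0 : U 0 = 1 := by simpa using hU 0 0
  let f : (Σ l : {l : (ZMod p)ˣ // ∃ z, U l * z = z * U j}, {z : G // U l.1 * z = z * U j}) →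
      {z : G // ∃ s, U 1 * z = z * U s} := fun x => ⟨x.2.1, by
    have h := map_mul_comm_of_map_add hU x.2.2 (x.1.1 : ZMod p)⁻¹
    rw [inv_mul_cancel₀ x.1.1.ne_zero] at h
    exact ⟨_, h⟩⟩
  have hf : Function.Bijective f := by
    constructor
    · rintro ⟨⟨l, hl⟩, ⟨z, hz⟩⟩ ⟨⟨l', hl'⟩, ⟨z', hz'⟩⟩ h
      obtain rfl : z = z' := congrArg Subtype.val h
      have h1 : (l : ZMod p) = l' := hinj (mul_right_cancel (hz.trans hz'.symm))
      obtain rfl : l = l' := Units.ext h1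
      rfl
    · rintro ⟨z, s, hs⟩
      have hs0 : s ≠ 0 := by
        rintro rfl
        rw [h0, mul_one, mul_eq_right, ← h0, hinj.eq_iff] at hs
        exact one_ne_zero hs
      have h := map_mul_comm_of_map_add hU hs (j * s⁻¹)
      rw [mul_one, inv_mul_cancel_right₀ hs0] at h
      let l : (ZMod p)ˣ := Units.mk0 (j * s⁻¹) (mul_ne_zero j.ne_zero (inv_ne_zero hs0))
      exact ⟨⟨⟨l, z, h⟩, ⟨z, h⟩⟩, rfl⟩
  have := Fintype.ofFinite {l : (ZMod p)ˣ // ∃ z, U l * z = z * U j}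
  rw [← Nat.card_congr (Equiv.ofBijective f hf), Nat.card_sigma,
    Finset.sum_congr rfl fun l _ => natCard_mul_eq_mul hU hinj hC l.1.ne_zero l.2,
    Finset.sum_const, Finset.card_univ, smul_eq_mul, mul_comm, ← Nat.card_eq_fintype_card] at he
  exact Nat.eq_of_mul_eq_mul_left hp he

theorem mem_normalizer_range_iff (hU : ∀ a b, U (a + b) = U a * U b)
    (hinj : Function.Injective U) {H : Subgroup G} (hH : ∀ x, x ∈ H ↔ x ∈ Set.range U) (z : G) :
    z ∈ Subgroup.normalizer (H : Set G) ↔ ∃ s, U 1 * z = z * U s := by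
  have h0 : U 0 = 1 := by simpa using hU 0 0
  rw [Subgroup.mem_normalizer_iff'']
  constructor
  · intro h
    obtain ⟨s, hs⟩ := (hH _).1 ((h (U 1)).1 ((hH _).2 ⟨1, rfl⟩))
    exact ⟨s, by rw [hs]; group⟩
  · rintro ⟨s, hs⟩ x
    have hs0 : s ≠ 0 := by
      rintro rfl
      rw [h0, mul_one, mul_eq_right, ← h0, hinj.eq_iff] at hs
      exact one_ne_zero hs
    simp only [hH]
    constructor
    · rintro ⟨a, rfl⟩
      have h := map_mul_comm_of_map_add hU hs a
      rw [mul_one] at h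
      exact ⟨a * s, by rw [mul_assoc, h, inv_mul_cancel_left]⟩
    · rintro ⟨b, hb⟩
      have h := map_mul_comm_of_map_add hU hs (b * s⁻¹)
      rw [mul_one, inv_mul_cancel_right₀ hs0, hb] at h
      refine ⟨b * s⁻¹, mul_right_cancel (b := z) ?_⟩
      rw [h]; group

theorem exists_map_add_of_orderOf_eq {u : G} (hu : orderOf u = p) :
    ∃ U : ZMod p → G, (∀ a b, U (a + b) = U a * U b) ∧ Function.Injective U ∧
      (∀ x, x ∈ Subgroup.zpowers u ↔ x ∈ Set.range U) := by
  have hmem : ∀ a : ZMod p, u ^ a.val ∈ Subgroup.zpowers u := fun a =>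
    (Subgroup.zpowers u).pow_mem (Subgroup.mem_zpowers u) _
  refine ⟨fun a => u ^ a.val, fun a b => ?_, fun a b h => ?_, fun x => ⟨fun hx => ?_, ?_⟩⟩
  · show u ^ (a + b).val = u ^ a.val * u ^ b.val
    have h := pow_mod_orderOf u (a.val + b.val)
    rw [hu] at h
    rw [← pow_add, ZMod.val_add, h]
  · have h1 := pow_inj_mod.1 h
    rw [hu, Nat.mod_eq_of_lt (ZMod.val_lt a), Nat.mod_eq_of_lt (ZMod.val_lt b)] at h1
    exact ZMod.val_injective p h1
  · obtain ⟨k, rfl⟩ := Subgroup.mem_zpowers_iff.1 hx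
    refine ⟨(k : ZMod p), ?_⟩
    have h1 : ((((k : ZMod p)).val : ℕ) : ℤ) = k % p := ZMod.val_intCast k
    show u ^ ((k : ZMod p)).val = u ^ k
    rw [← zpow_natCast, h1, ← hu, zpow_mod_orderOf]
  · rintro ⟨a, rfl⟩
    exact hmem a

theorem dvd_and_not_of_card_normalizer_eq [Finite G] (hG : IsSimpleGroup G)
    (hnab : ¬ ∀ a b : G, a * b = b * a) (hp19 : 19 ≤ p) (hdvd : Nat.card G ∣ 576 * p) {u : G}
    (hu : orderOf u = p) (hC : ∀ z, u * z = z * u → z ∈ Subgroup.zpowers u) {e : ℕ}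
    (he : Nat.card (Subgroup.normalizer (Subgroup.zpowers u : Set G)) = p * e) :
    e ∣ p - 1 ∧ ¬ (e = 1 ∨ e = 2 ∨ (e = 3 ∨ e = 6) ∧ (p = 19 ∨ p = 31)) := by
  have hp : p.Prime := Fact.out
  obtain ⟨U, hU, hinj, hmem⟩ := exists_map_add_of_orderOf_eq hu
  have hC' : ∀ z, U 1 * z = z * U 1 → z ∈ Set.range U := by
    intro z hz
    rw [← hmem]
    obtain ⟨a, ha⟩ := (hmem u).1 (Subgroup.mem_zpowers u)
    refine hC z ?_
    have := map_mul_comm_of_map_add hU hz a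
    rwa [mul_one, ha] at this
  have he' : Nat.card {z : G // ∃ s, U 1 * z = z * U s} = p * e := by
    rw [← he]
    exact Nat.card_congr (Equiv.subtypeEquivRight fun z =>
      (mem_normalizer_range_iff hU hinj hmem z).symm)
  have hR := equivalence_exists_mul_eq_mul fun j : (ZMod p)ˣ => U j
  have hclass := card_class_eq hU hinj hC' he'
  have hcardX : Nat.card (ZMod p)ˣ = p - 1 := by
    rw [Nat.card_eq_fintype_card, ZMod.card_units]
  refine ⟨hcardX ▸ dvd_card_of_equivalence hR hclass, fun hcase => ?_⟩
  obtain ⟨k, n, a, i₀, h1, h2, h3, h4, h5, h6, h7, h8⟩ :=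
    exists_degrees_and_multiplicities hG hnab hU hinj hC' he'
  refine false_of_degrees_and_multiplicities (X := (ZMod p)ˣ) (a := fun i j => a i j)
    hp hp19 hR ?_ hclass (fun i => (h1 i).trans hdvd) h2 h3 (fun j => h4 j j.ne_zero)
    (fun j => h5 j) (fun i => ?_) (fun j l => h8 j l j.ne_zero l.ne_zero) hcase
  · rw [ZMod.card_units]
    exact Nat.sub_add_cancel hp.one_le
  · have h := h6 i
    rwa [Fintype.sum_eq_add_sum_subtype_ne _ 0, h7, zero_add,
      ← Equiv.sum_comp (unitsEquivNeZero : (ZMod p)ˣ ≃ _)] at h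

end SelfCentralizing

section SylowActions

open MulAction

variable {G : Type*} [Group G] {p : ℕ}

theorem Sylow.smul_eq_of_mem {P : Sylow p G} {g : G} (hg : g ∈ P) : g • P = P :=
  Sylow.smul_eq_iff_mem_normalizer.2 (Subgroup.le_normalizer hg)

theorem Sylow.eq_of_forall_smul_eq {P Q : Sylow p G} (h : ∀ g ∈ P, g • Q = Q) : P = Q := by
  have h1 : (P : Subgroup G) ≤ Q := by
    rw [← inf_eq_left, ← P.isPGroup'.inf_normalizer_sylow Q, inf_eq_left]
    exact fun g hg => Sylow.smul_eq_iff_mem_normalizer.1 (h g hg)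
  exact Sylow.ext (P.is_maximal' Q.isPGroup' h1).symm

theorem card_orbit_sylow_mul_dvd (P : Sylow p G) {H : Subgroup G} (hPH : (P : Subgroup G) ≤ H) :
    Nat.card (orbit H P) * Nat.card P ∣ Nat.card H := by
  rw [← Subgroup.card_mul_index (stabilizer H P), MulAction.index_stabilizer,
    ← Nat.card_coe_set_eq, mul_comm]
  refine mul_dvd_mul_right ?_ _
  have h : ∀ g : P, Subgroup.inclusion hPH g ∈ stabilizer H P := fun g =>
    Sylow.smul_eq_of_mem g.2
  exact Subgroup.card_dvd_of_injective ((Subgroup.inclusion hPH).codRestrict _ h) fun a b hab =>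
    Subtype.ext (congrArg (fun x : stabilizer H P => ((x : H) : G)) hab)

variable [Finite G] [Fact p.Prime]

theorem IsPGroup.false_of_isSimpleGroup (hG : IsSimpleGroup G)
    (hnab : ¬ ∀ a b : G, a * b = b * a) : ¬ IsPGroup p G := by
  intro h
  have := hG.toNontrivial
  have h1 := h.center_nontrivial
  rcases hG.eq_bot_or_eq_top_of_normal (Subgroup.center G) inferInstance with h2 | h2
  · exact (Subgroup.nontrivial_iff_ne_bot _).1 h1 h2
  · refine hnab fun a b => ?_
    have : b ∈ Subgroup.center G := h2 ▸ Subgroup.mem_top b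
    exact Subgroup.mem_center_iff.1 this a

theorem card_sylow_ne_one (hG : IsSimpleGroup G) (hnab : ¬ ∀ a b : G, a * b = b * a)
    (hp : p ∣ Nat.card G) : Nat.card (Sylow p G) ≠ 1 := by
  intro h
  have := (Nat.card_eq_one_iff_unique.1 h).1
  obtain ⟨P⟩ : Nonempty (Sylow p G) := inferInstance
  have hP : (P : Subgroup G).Normal := P.normal_of_subsingleton
  rcases hG.eq_bot_or_eq_top_of_normal (P : Subgroup G) hP with h1 | h1
  · exact P.ne_bot_of_dvd_card hp h1
  · refine IsPGroup.false_of_isSimpleGroup (p := p) hG hnab ?_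
    have h2 := P.isPGroup'
    rw [h1] at h2
    exact h2.of_equiv Subgroup.topEquiv

theorem eq_one_of_forall_smul_sylow_eq (hG : IsSimpleGroup G) (hn : Nat.card (Sylow p G) ≠ 1)
    {g : G} (hg : ∀ Q : Sylow p G, g • Q = Q) : g = 1 := by
  rcases hG.eq_bot_or_eq_top_of_normal (MulAction.toPermHom G (Sylow p G)).ker inferInstance
    with h | h
  · have : g ∈ (MulAction.toPermHom G (Sylow p G)).ker := by
      rw [MonoidHom.mem_ker]
      ext1 Q
      exact hg Q
    rwa [h, Subgroup.mem_bot] at this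
  · refine absurd ?_ hn
    rw [Nat.card_eq_one_iff_unique]
    refine ⟨⟨fun P Q => ?_⟩, inferInstance⟩
    obtain ⟨g, rfl⟩ := exists_smul_eq G P Q
    have h1 : g ∈ (MulAction.toPermHom G (Sylow p G)).ker := h ▸ Subgroup.mem_top g
    exact (congrArg (fun σ : Equiv.Perm (Sylow p G) => σ P) h1).symm

theorem card_orbit_sylow_modEq_one {P : Sylow p G} {H : Subgroup G} (hPH : (P : Subgroup G) ≤ H) :
    Nat.card (orbit H P) ≡ 1 [MOD p] := by
  let f : P →* H := Subgroup.inclusion hPH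
  let _ : MulAction P (orbit H P) := MulAction.compHom _ f
  have h := P.isPGroup'.card_modEq_card_fixedPoints (orbit H P)
  refine h.trans ?_
  have : Nat.card (fixedPoints P (orbit H P)) = 1 := by
    rw [Nat.card_eq_one_iff_unique]
    refine ⟨⟨?_⟩, ⟨⟨⟨P, mem_orbit_self P⟩, fun g => ?_⟩⟩⟩
    · have key : ∀ Q : fixedPoints P (orbit H P), P = Q.1.1 := fun Q =>
        Sylow.eq_of_forall_smul_eq fun g hg => congrArg Subtype.val (Q.2 ⟨g, hg⟩)
      intro Q R
      exact Subtype.ext (Subtype.ext ((key Q).symm.trans (key R)))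
    · refine Subtype.ext ?_
      show (g : G) • P = P
      exact Sylow.smul_eq_of_mem g.2
  rw [this]

end SylowActions

section Centralizers

open MulAction

variable {G : Type*} [Group G] [Finite G] {p q : ℕ}

theorem sq_dvd_card_centralizer [Fact q.Prime] (hq : q ^ 2 ∣ Nat.card G) {x : G}
    (hx : orderOf x = q) : q ^ 2 ∣ Nat.card (Subgroup.centralizer {x}) := by
  have hqp : q.Prime := Fact.out
  have h1 : IsPGroup q (Subgroup.zpowers x) :=
    IsPGroup.of_card (n := 1) (by rw [Nat.card_zpowers, hx, pow_one])
  obtain ⟨Q, hQ⟩ := h1.exists_le_sylow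
  have hxQ : x ∈ Q := hQ (Subgroup.mem_zpowers x)
  have hQ2 : q ^ 2 ∣ Nat.card Q := Q.pow_dvd_card_of_pow_dvd_card hq
  set C : Subgroup Q := Subgroup.centralizer {⟨x, hxQ⟩} with hC
  have hCd : Nat.card C ∣ Nat.card (Subgroup.centralizer {x}) := by
    have h2 : ∀ z : C, ((z : Q) : G) ∈ Subgroup.centralizer {x} := fun z => by
      rw [Subgroup.mem_centralizer_singleton_iff]
      exact congrArg Subtype.val (Subgroup.mem_centralizer_singleton_iff.1 z.2)
    exact Subgroup.card_dvd_of_injective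
      (((Q : Subgroup G).subtype.comp C.subtype).codRestrict _ h2) fun a b hab =>
        Subtype.ext (Subtype.ext (congrArg (fun y : Subgroup.centralizer {x} => (y : G)) hab))
  refine dvd_trans ?_ hCd
  obtain ⟨j, hj⟩ := IsPGroup.iff_card.1 (Q.isPGroup'.to_subgroup C)
  rw [hj]
  refine pow_dvd_pow q ?_
  by_contra! hj2
  have hQnt : Nontrivial Q :=
    Finite.one_lt_card_iff_nontrivial.1 ((Nat.one_lt_pow two_ne_zero hqp.one_lt).trans_le
      (Nat.le_of_dvd Nat.card_pos hQ2))
  have := Q.isPGroup'.center_nontrivial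
  obtain ⟨i, hi⟩ := IsPGroup.iff_card.1 (Q.isPGroup'.to_subgroup (Subgroup.center Q))
  have hi0 : i ≠ 0 := by
    rintro rfl
    exact (Finite.one_lt_card_iff_nontrivial.2 this).ne' hi
  have hle : Subgroup.center Q ≤ C := Subgroup.center_le_centralizer _
  have hcard : Nat.card C ≤ Nat.card (Subgroup.center Q) := by
    rw [hi, hj]
    exact Nat.pow_le_pow_right hqp.pos (by omega)
  have heq : Subgroup.center Q = C := Subgroup.eq_of_le_of_card_ge hle hcard
  have hxC : (⟨x, hxQ⟩ : Q) ∈ Subgroup.center Q := by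
    rw [heq, hC, Subgroup.mem_centralizer_singleton_iff]
  have hCtop : C = ⊤ := by
    rw [eq_top_iff]
    intro z _
    rw [hC, Subgroup.mem_centralizer_singleton_iff]
    exact Subgroup.mem_center_iff.1 hxC z
  have hQC : Nat.card C = Nat.card Q := by rw [hCtop, Subgroup.card_top]
  rw [← hQC, hj, Nat.pow_dvd_pow_iff_le_right hqp.one_lt] at hQ2
  omega

theorem card_fixed_sylow_modEq [Fact q.Prime] {x : G} (hx : orderOf x = q) :
    Nat.card (Sylow p G) ≡ Nat.card {Q : Sylow p G // x • Q = Q} [MOD q] := by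
  have h1 : IsPGroup q (Subgroup.zpowers x) :=
    IsPGroup.of_card (n := 1) (by rw [Nat.card_zpowers, hx, pow_one])
  refine (h1.card_modEq_card_fixedPoints (Sylow p G)).trans ?_
  have : Nat.card (fixedPoints (Subgroup.zpowers x) (Sylow p G)) =
      Nat.card {Q : Sylow p G // x • Q = Q} := by
    refine Nat.card_congr (Equiv.subtypeEquivRight fun Q => ?_)
    constructor
    · exact fun h => h ⟨x, Subgroup.mem_zpowers x⟩
    · rintro h ⟨g, hg⟩
      have : Subgroup.zpowers x ≤ stabilizer G Q := by
        rw [Subgroup.zpowers_le]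
        exact h
      exact this hg
  rw [this]

variable [Fact p.Prime]

theorem card_fixed_sylow_modEq_one {P : Sylow p G} {x : G} (hx : ∀ g ∈ P, x * g = g * x) :
    Nat.card {Q : Sylow p G // x • Q = Q} ≡ 1 [MOD p] := by
  let _ : MulAction P {Q : Sylow p G // x • Q = Q} :=
    { smul := fun g Q => ⟨(g : G) • Q.1, by
        rw [← mul_smul, hx g g.2, mul_smul, Q.2]⟩
      one_smul := fun Q => Subtype.ext (one_smul G Q.1)
      mul_smul := fun g h Q => Subtype.ext (mul_smul (g : G) (h : G) Q.1) }
  have hxP : x • P = P :=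
    Sylow.smul_eq_iff_mem_normalizer.2 (Subgroup.centralizer_le_normalizer _
      (Subgroup.mem_centralizer_iff.2 fun g hg => (hx g hg).symm))
  refine (P.isPGroup'.card_modEq_card_fixedPoints _).trans ?_
  have : Nat.card (fixedPoints P {Q : Sylow p G // x • Q = Q}) = 1 := by
    rw [Nat.card_eq_one_iff_unique]
    refine ⟨⟨?_⟩, ⟨⟨⟨P, hxP⟩, fun g => Subtype.ext (Sylow.smul_eq_of_mem g.2)⟩⟩⟩
    have key : ∀ Q : fixedPoints P {Q : Sylow p G // x • Q = Q}, P = Q.1.1 := fun Q =>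
      Sylow.eq_of_forall_smul_eq fun g hg => congrArg Subtype.val (Q.2 ⟨g, hg⟩)
    intro Q R
    exact Subtype.ext (Subtype.ext ((key Q).symm.trans (key R)))
  rw [this]

theorem not_commute_sylow_of_card_eq_succ [Fact q.Prime] (hG : IsSimpleGroup G)
    (hn : Nat.card (Sylow p G) = p + 1) (hqp : q ≠ p) (P : Sylow p G) {x : G} (hx : orderOf x = q) :
    ¬ ∀ g ∈ P, x * g = g * x := by
  intro hc
  have hpp : p.Prime := Fact.out
  have hqq : q.Prime := Fact.out
  have h1 := card_fixed_sylow_modEq_one hc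
  have h2 := card_fixed_sylow_modEq (p := p) hx
  have hle : Nat.card {Q : Sylow p G // x • Q = Q} ≤ p + 1 := hn ▸ Nat.card_le_card_of_injective
    (Subtype.val : {Q : Sylow p G // x • Q = Q} → Sylow p G) Subtype.val_injective
  have h3 : Nat.card {Q : Sylow p G // x • Q = Q} = p + 1 := by
    set m := Nat.card {Q : Sylow p G // x • Q = Q}
    have hm0 : m ≠ 0 := by
      intro h
      rw [h] at h1
      exact hpp.one_lt.ne' (Nat.dvd_one.1 ((Nat.modEq_iff_dvd' (Nat.zero_le 1)).1 h1))
    obtain ⟨c, hc⟩ := (Nat.modEq_iff_dvd' (Nat.one_le_iff_ne_zero.2 hm0)).1 h1.symm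
    rcases Nat.lt_or_ge c 1 with h | h
    · obtain rfl : c = 0 := by omega
      obtain hm1 : m = 1 := by omega
      rw [hn, hm1] at h2
      have h4 := (Nat.modEq_iff_dvd' (by omega)).1 h2.symm
      rw [Nat.add_sub_cancel] at h4
      exact absurd ((Nat.prime_dvd_prime_iff_eq hqq hpp).1 h4) hqp
    · have := Nat.mul_le_mul_left p h
      omega
  have h5 : ∀ Q : Sylow p G, x • Q = Q := by
    have hb := (Nat.bijective_iff_injective_and_card
      (Subtype.val : {Q : Sylow p G // x • Q = Q} → Sylow p G)).2
      ⟨Subtype.val_injective, h3.trans hn.symm⟩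
    intro Q
    obtain ⟨R, rfl⟩ := hb.2 Q
    exact R.2
  have h6 := eq_one_of_forall_smul_sylow_eq hG (by have := hpp.two_le; omega) h5
  rw [h6, orderOf_one] at hx
  exact hqq.one_lt.ne hx

theorem not_commute_sylow_of_sq_dvd [Fact q.Prime] (hG : IsSimpleGroup G)
    (hn : Nat.card (Sylow p G) ≠ 1) {P : Sylow p G}
    (hm : ∀ m, m ≡ 1 [MOD p] → m * Nat.card P ∣ Nat.card G → m = 1 ∨ m = Nat.card (Sylow p G))
    (hq : q ^ 2 ∣ Nat.card G) (hqN : ¬ q ^ 2 ∣ Nat.card (Subgroup.normalizer (P : Set G)))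
    {x : G} (hx : orderOf x = q) : ¬ ∀ g ∈ P, x * g = g * x := by
  intro hc
  have hqq : q.Prime := Fact.out
  set H := Subgroup.centralizer {x}
  have hPH : (P : Subgroup G) ≤ H := fun g hg =>
    Subgroup.mem_centralizer_singleton_iff.2 (hc g hg).symm
  have hxP : x • P = P :=
    Sylow.smul_eq_iff_mem_normalizer.2 (Subgroup.centralizer_le_normalizer _
      (Subgroup.mem_centralizer_iff.2 fun g hg => (hc g hg).symm))
  rcases hm _ (card_orbit_sylow_modEq_one hPH)
    ((card_orbit_sylow_mul_dvd P hPH).trans H.card_subgroup_dvd_card) with h | h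
  · have hHN : H ≤ Subgroup.normalizer (P : Set G) := by
      intro h' hh
      have hs := (Nat.card_eq_one_iff_unique.1 h).1
      have := congrArg Subtype.val (hs.elim ⟨(⟨h', hh⟩ : H) • P, mem_orbit P _⟩
        ⟨P, mem_orbit_self P⟩)
      exact Sylow.smul_eq_iff_mem_normalizer.1 this
    exact hqN ((sq_dvd_card_centralizer hq hx).trans (Subgroup.card_dvd_of_le hHN))
  · have hb := (Nat.bijective_iff_injective_and_card
      (Subtype.val : orbit H P → Sylow p G)).2 ⟨Subtype.val_injective, h⟩
    have h5 : ∀ Q : Sylow p G, x • Q = Q := by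
      intro Q
      obtain ⟨⟨_, ⟨g, hg⟩, rfl⟩, rfl⟩ := hb.2 Q
      show x • g • P = g • P
      rw [← mul_smul, ← Subgroup.mem_centralizer_singleton_iff.1 hg, mul_smul, hxP]
    rw [eq_one_of_forall_smul_sylow_eq hG hn h5, orderOf_one] at hx
    exact hqq.one_lt.ne hx

end Centralizers

section PrimeDividesOrder

theorem prime_and_divisor_cases {p n : ℕ} (hp : p.Prime) (hp19 : 19 ≤ p) (hn : n ∣ 576)
    (hn1 : n ≠ 1) (h : n ≡ 1 [MOD p]) :
    n = p + 1 ∧ (p = 23 ∨ p = 31 ∨ p = 47 ∨ p = 71 ∨ p = 191) ∨ p = 23 ∧ n = 576 ∨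
      p = 19 ∧ n = 96 ∨ p = 41 ∧ n = 288 := by
  have key : ∀ n ∈ Nat.divisors 576, n ≠ 1 → ∀ p ∈ Nat.divisors (n - 1), 19 ≤ p → p.Prime →
      n = p + 1 ∧ (p = 23 ∨ p = 31 ∨ p = 47 ∨ p = 71 ∨ p = 191) ∨ p = 23 ∧ n = 576 ∨
      p = 19 ∧ n = 96 ∨ p = 41 ∧ n = 288 := by
    decide +kernel
  have hn0 : 0 < n := Nat.pos_of_dvd_of_pos hn (by norm_num)
  have hd := (Nat.modEq_iff_dvd' hn0).1 h.symm
  exact key n (Nat.mem_divisors.2 ⟨hn, by norm_num⟩) hn1 p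
    (Nat.mem_divisors.2 ⟨hd, by omega⟩) hp19 hp

theorem sq_dvd_and_not_sq_dvd {p n k q : ℕ} (h : p = 19 ∧ n = 96 ∨ p = 41 ∧ n = 288)
    (hk : k * n ∣ 576) (hq : q.Prime) (hqk : q ∣ k) : q ^ 2 ∣ p * k * n ∧ ¬ q ^ 2 ∣ p * k := by
  have key : ∀ k ∈ Nat.divisors 576, ∀ q ∈ Nat.divisors k, q.Prime →
      (k * 96 ∣ 576 → q ^ 2 ∣ 19 * k * 96 ∧ ¬ q ^ 2 ∣ 19 * k) ∧
      (k * 288 ∣ 576 → q ^ 2 ∣ 41 * k * 288 ∧ ¬ q ^ 2 ∣ 41 * k) := by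
    decide +kernel
  have hk' : k ∈ Nat.divisors 576 :=
    Nat.mem_divisors.2 ⟨(dvd_mul_right _ _).trans hk, by norm_num⟩
  have hq' : q ∈ Nat.divisors k :=
    Nat.mem_divisors.2 ⟨hqk, (Nat.pos_of_mem_divisors hk').ne'⟩
  rcases h with ⟨rfl, rfl⟩ | ⟨rfl, rfl⟩
  · exact (key k hk' q hq' hq).1 hk
  · exact (key k hk' q hq' hq).2 hk

theorem normalizer_index_cases {p n k : ℕ}
    (h : n = p + 1 ∧ (p = 23 ∨ p = 31 ∨ p = 47 ∨ p = 71 ∨ p = 191) ∨ p = 23 ∧ n = 576 ∨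
      p = 19 ∧ n = 96 ∨ p = 41 ∧ n = 288) (hk : k * n ∣ 576) (hkp : k ∣ p - 1) :
    k = 1 ∨ k = 2 ∨ (k = 3 ∨ k = 6) ∧ (p = 19 ∨ p = 31) := by
  have hk' : k ∈ Nat.divisors 576 :=
    Nat.mem_divisors.2 ⟨(dvd_mul_right _ _).trans hk, by norm_num⟩
  have key : ∀ k ∈ Nat.divisors 576, ∀ p ∈ [19, 23, 31, 41, 47, 71, 191],
      k * (p + 1) ∣ 576 ∨ p = 23 ∧ k * 576 ∣ 576 ∨ p = 19 ∧ k * 96 ∣ 576 ∨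
        p = 41 ∧ k * 288 ∣ 576 → k ∣ p - 1 →
      k = 1 ∨ k = 2 ∨ (k = 3 ∨ k = 6) ∧ (p = 19 ∨ p = 31) := by
    decide +kernel
  refine key k hk' p ?_ ?_ hkp
  · simp only [List.mem_cons, List.not_mem_nil]
    omega
  · rcases h with ⟨rfl, -⟩ | ⟨rfl, rfl⟩ | ⟨rfl, rfl⟩ | ⟨rfl, rfl⟩ <;> simp [hk]

variable {G : Type*} [Group G] [Finite G] {p : ℕ} [Fact p.Prime]

theorem not_dvd_card_of_isSimpleGroup (hG : IsSimpleGroup G)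
    (hnab : ¬ ∀ a b : G, a * b = b * a) (hp19 : 19 ≤ p) (hdvd : Nat.card G ∣ 576 * p) :
    ¬ p ∣ Nat.card G := by
  intro hpG
  have hp : p.Prime := Fact.out
  have hp576 : ¬ p ∣ 576 := by
    intro h
    rw [show 576 = 2 ^ 6 * 3 ^ 2 by norm_num, hp.dvd_mul] at h
    rcases h with h | h <;> have := Nat.le_of_dvd (by norm_num) (hp.dvd_of_dvd_pow h) <;> omega
  obtain ⟨P⟩ : Nonempty (Sylow p G) := inferInstance
  have hPcard : Nat.card P = p := by
    obtain ⟨i, hi⟩ := IsPGroup.iff_card.1 P.isPGroup'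
    have hpP := P.dvd_card_of_dvd_card hpG
    match i with
    | 0 => exact absurd (hi ▸ hpP) (by simpa using hp.ne_one)
    | 1 => rw [hi, pow_one]
    | i + 2 =>
      refine absurd (Nat.dvd_of_mul_dvd_mul_right hp.pos (dvd_trans ?_ hdvd)) hp576
      refine dvd_trans ⟨p ^ i, ?_⟩ (P : Subgroup G).card_subgroup_dvd_card
      rw [hi]
      ring
  obtain ⟨u, huP, hu⟩ : ∃ u ∈ P, orderOf u = p := by
    obtain ⟨u, hu⟩ := exists_prime_orderOf_dvd_card' p (dvd_of_eq hPcard.symm)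
    exact ⟨u, u.2, by rw [Subgroup.orderOf_coe, hu]⟩
  have hPu : (P : Subgroup G) = Subgroup.zpowers u :=
    (Subgroup.eq_of_le_of_card_ge (Subgroup.zpowers_le.2 huP)
      (by rw [Nat.card_zpowers, hu]; exact hPcard.le)).symm
  have hnp := card_sylow_modEq_one p G
  have hn1 := card_sylow_ne_one (p := p) hG hnab hpG
  have hnN := (Subgroup.normalizer (P : Set G)).card_mul_index
  rw [← Sylow.card_eq_index_normalizer P] at hnN
  obtain ⟨k, hk⟩ : p ∣ Nat.card (Subgroup.normalizer (P : Set G)) :=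
    (dvd_of_eq hPcard.symm).trans (Subgroup.card_dvd_of_le Subgroup.le_normalizer)
  set n := Nat.card (Sylow p G) with hn
  have hkn : k * n ∣ 576 := by
    refine Nat.dvd_of_mul_dvd_mul_right hp.pos ?_
    rw [show k * n * p = p * k * n by ring, ← hk, hnN]
    exact hdvd
  have hGkn : Nat.card G = p * k * n := by rw [← hnN, hk]
  have hcases := prime_and_divisor_cases hp hp19 ((dvd_mul_left _ _).trans hkn) hn1 hnp
  have hcomm : ∀ x : G, u * x = x * u → ∀ g ∈ P, x * g = g * x := by
    intro x hx g hg
    have hg' : g ∈ Subgroup.zpowers u := hPu ▸ hg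
    obtain ⟨i, rfl⟩ := hg'
    exact ((show Commute u x from hx).zpow_left i).symm
  have hk0 : k ≠ 0 := by
    rintro rfl
    simp at hkn
  have hq : ∀ q : ℕ, q.Prime → q ∣ k → ∀ x : G, orderOf x = q → ¬ u * x = x * u := by
    intro q hqq hqk x hx hux
    have : Fact q.Prime := ⟨hqq⟩
    have h1 := hcomm x hux
    have hq576 : q ∣ 576 := (hqk.trans (dvd_mul_right _ _)).trans hkn
    rcases hcases with ⟨h, -⟩ | ⟨h, h'⟩ | ⟨h, h'⟩ | ⟨h, h'⟩
    · exact not_commute_sylow_of_card_eq_succ hG h (by rintro rfl; exact hp576 hq576) P hx h1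
    · rw [h'] at hkn
      have : k ∣ 1 := Nat.dvd_of_mul_dvd_mul_right (by norm_num : 0 < 576) hkn
      exact hqq.one_lt.ne' (Nat.dvd_one.1 (hqk.trans this))
    all_goals
      have hsq := sq_dvd_and_not_sq_dvd (p := p) (n := n) (by omega) hkn hqq hqk
      refine not_commute_sylow_of_sq_dvd hG hn1 ?_ ?_ ?_ hx h1
      · intro m hm hmd
        rw [hPcard, hGkn, mul_assoc, mul_comm] at hmd
        have hmd' := (Nat.dvd_of_mul_dvd_mul_left hp.pos hmd)
        by_cases hm1 : m = 1
        · exact Or.inl hm1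
        · have := prime_and_divisor_cases hp hp19 (hmd'.trans hkn) hm1 hm
          omega
      · exact hGkn ▸ hsq.1
      · exact hk ▸ hsq.2
  have hC : ∀ z, u * z = z * u → z ∈ Subgroup.zpowers u := by
    have hCN : Subgroup.centralizer {u} ≤ Subgroup.normalizer (P : Set G) := by
      intro x hx
      refine Subgroup.centralizer_le_normalizer _ (Subgroup.mem_centralizer_iff.2 fun g hg => ?_)
      exact (hcomm x (Subgroup.mem_centralizer_singleton_iff.1 hx).symm g hg).symm
    have hPC : Subgroup.zpowers u ≤ Subgroup.centralizer {u} := by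
      rw [Subgroup.zpowers_le, Subgroup.mem_centralizer_singleton_iff]
    obtain ⟨c, hc⟩ : p ∣ Nat.card (Subgroup.centralizer {u}) := by
      have := Subgroup.card_dvd_of_le hPC
      rwa [Nat.card_zpowers, hu] at this
    have hck : c ∣ k := by
      have := Subgroup.card_dvd_of_le hCN
      rw [hc, hk] at this
      exact Nat.dvd_of_mul_dvd_mul_left hp.pos this
    have hc1 : c = 1 := by
      by_contra hc1
      obtain ⟨q, hqq, hqc⟩ := Nat.exists_prime_and_dvd hc1
      have : Fact q.Prime := ⟨hqq⟩
      obtain ⟨x, hx⟩ := exists_prime_orderOf_dvd_card' (G := Subgroup.centralizer {u}) q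
        (hc ▸ hqc.mul_left p)
      exact hq q hqq (hqc.trans hck) x (by rw [Subgroup.orderOf_coe, hx])
        (Subgroup.mem_centralizer_singleton_iff.1 x.2).symm
    have hPC' := Subgroup.eq_of_le_of_card_ge hPC
      (by rw [hc, hc1, Nat.card_zpowers, hu, mul_one])
    intro z hz
    rw [hPC', Subgroup.mem_centralizer_singleton_iff]
    exact hz.symm
  have hk' : Nat.card (Subgroup.normalizer (Subgroup.zpowers u : Set G)) = p * k := by
    rw [← hPu]
    exact hk
  obtain ⟨hkp, hknot⟩ := dvd_and_not_of_card_normalizer_eq hG hnab hp19 hdvd hu hC hk'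
  refine hknot ?_
  exact normalizer_index_cases hcases hkn hkp

end PrimeDividesOrder

section TwoThreeGroups

open MulAction

variable {G : Type*} [Group G] [Finite G] {p q : ℕ}

theorem card_dvd_factorial_card_sylow [Fact p.Prime] (hG : IsSimpleGroup G)
    (hn : Nat.card (Sylow p G) ≠ 1) :
    Nat.card G ∣ (Nat.card (Sylow p G)).factorial := by
  rw [← Nat.card_perm]
  refine Subgroup.card_dvd_of_injective (MulAction.toPermHom G (Sylow p G))
    ((injective_iff_map_eq_one _).2 fun g hg => eq_one_of_forall_smul_sylow_eq (p := p) hG hn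
      fun Q => ?_)
  exact congrArg (fun σ : Equiv.Perm (Sylow p G) => σ Q) hg

theorem even_card_moved_sylow_div_two (hG : IsSimpleGroup G)
    (hnab : ¬ ∀ a b : G, a * b = b * a) {t : G} (ht : t ^ 2 = 1) :
    Even ((Nat.card (Sylow p G) - Nat.card {Q : Sylow p G // t • Q = Q}) / 2) := by
  classical
  have := Fintype.ofFinite (Sylow p G)
  set σ : Equiv.Perm (Sylow p G) := MulAction.toPermHom G (Sylow p G) t with hσ
  have h1 : Equiv.Perm.sign σ = 1 :=
    MonoidHom.eq_one_of_isSimpleGroup hG hnab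
      (Equiv.Perm.sign.comp (MulAction.toPermHom G (Sylow p G))) t
  rw [Equiv.Perm.sign_of_pow_two_eq_one (by rw [hσ, ← map_pow, ht, map_one])] at h1
  have h2 : Nat.card {Q : Sylow p G // t • Q = Q} = Fintype.card (Function.fixedPoints σ) := by
    rw [← Nat.card_eq_fintype_card]
    rfl
  rw [h2, Nat.card_eq_fintype_card]
  exact neg_one_pow_eq_one_iff_even (by decide) |>.1 h1

theorem card_fixed_sylow_modEq_zero [Fact q.Prime] {x t : G} {k : ℕ} (hx : orderOf x = q ^ k)
    (hxt : x * t = t * x) (hfix : ∀ Q : Sylow p G, x • Q ≠ Q) :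
    q ∣ Nat.card {Q : Sylow p G // t • Q = Q} := by
  have hcz : ∀ g : Subgroup.zpowers x, (g : G) * t = t * g := by
    rintro ⟨_, i, rfl⟩
    exact (show Commute x t from hxt).zpow_left i
  let _ : MulAction (Subgroup.zpowers x) {Q : Sylow p G // t • Q = Q} :=
    { smul := fun g Q => ⟨(g : G) • Q.1, by
        rw [← mul_smul, ← hcz g, mul_smul, Q.2]⟩
      one_smul := fun Q => Subtype.ext (one_smul G Q.1)
      mul_smul := fun g h Q => Subtype.ext (mul_smul (g : G) (h : G) Q.1) }
  have h1 : IsPGroup q (Subgroup.zpowers x) := IsPGroup.of_card (n := k) (by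
    rw [Nat.card_zpowers, hx])
  have h2 := h1.card_modEq_card_fixedPoints {Q : Sylow p G // t • Q = Q}
  have h3 : Nat.card (fixedPoints (Subgroup.zpowers x) {Q : Sylow p G // t • Q = Q}) = 0 := by
    have : IsEmpty (fixedPoints (Subgroup.zpowers x) {Q : Sylow p G // t • Q = Q}) :=
      ⟨fun Q => hfix Q.1.1 (congrArg Subtype.val (Q.2 ⟨x, Subgroup.mem_zpowers x⟩))⟩
    exact Nat.card_of_isEmpty
  rw [h3] at h2
  exact (Nat.modEq_zero_iff_dvd).1 h2

theorem exists_ne_one_mem_sylow_inter {R : Sylow p G}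
    (h : ¬ Nat.card R ∣ Nat.card (Sylow p G) - 1) :
    ∃ Q : Sylow p G, Q ≠ R ∧ ∃ g : G, g ≠ 1 ∧ g ∈ R ∧ g ∈ Q := by
  by_contra! hcon
  refine h ?_
  let _ : MulAction R {Q : Sylow p G // Q ≠ R} :=
    { smul := fun g Q => ⟨(g : G) • Q.1, fun hQ => Q.2 <| by
        rw [← inv_smul_smul (g : G) Q.1, hQ]
        exact Sylow.smul_eq_of_mem (inv_mem g.2)⟩
      one_smul := fun Q => Subtype.ext (one_smul G Q.1)
      mul_smul := fun g h Q => Subtype.ext (mul_smul (g : G) (h : G) Q.1) }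
  have hstab : ∀ Q : {Q : Sylow p G // Q ≠ R}, stabilizer R Q = ⊥ := by
    intro Q
    rw [eq_bot_iff]
    intro g hg
    rw [Subgroup.mem_bot]
    by_contra hg1
    refine hcon Q.1 Q.2 g (fun hg' => hg1 (Subtype.ext hg')) g.2 ?_
    have h1 : (g : G) ∈ (R : Subgroup G) ⊓ Subgroup.normalizer (Q.1 : Set G) :=
      ⟨g.2, Sylow.smul_eq_iff_mem_normalizer.1 (congrArg Subtype.val hg)⟩
    rw [R.isPGroup'.inf_normalizer_sylow] at h1
    exact h1.2
  have h1 := Nat.card_congr (selfEquivOrbitsQuotientProd hstab)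
  rw [Nat.card_prod] at h1
  have h2 : Nat.card {Q : Sylow p G // Q ≠ R} = Nat.card (Sylow p G) - 1 := by
    classical
    have := Fintype.ofFinite (Sylow p G)
    rw [Nat.card_eq_fintype_card, Nat.card_eq_fintype_card, Fintype.card_subtype_compl,
      Fintype.card_subtype_eq]
  rw [← h2, h1]
  exact dvd_mul_left _ _

theorem normalizer_sylow_ne_of_commute [Fact p.Prime] (hG : IsSimpleGroup G)
    (hnab : ¬ ∀ a b : G, a * b = b * a) (hp : p ∣ Nat.card G) {P : Sylow p G}
    (hP : ∀ a ∈ P, ∀ b ∈ P, a * b = b * a) : Subgroup.normalizer (P : Set G) ≠ P := by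
  intro hN
  have hle : Subgroup.normalizer (P : Set G) ≤ Subgroup.centralizer (P : Set G) := by
    rw [hN]
    intro a ha
    rw [Subgroup.mem_centralizer_iff]
    exact fun b hb => hP b hb a ha
  have h1 := MonoidHom.not_dvd_card_ker_transferSylow P hle
  have h2 : (MonoidHom.transferSylow P hle).ker = ⊤ := by
    rw [eq_top_iff]
    intro g _
    rw [MonoidHom.mem_ker]
    let _ : CommGroup P :=
      { mul_comm := fun a b => Subtype.ext (hP a a.2 b b.2) }
    exact MonoidHom.eq_one_of_isSimpleGroup hG hnab (M := P) (MonoidHom.transferSylow P hle) g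
  rw [h2, Subgroup.card_top] at h1
  exact h1 hp

end TwoThreeGroups

section OrderDvd576

theorem dvd_576_cases {n : ℕ} (h : n ∣ 576) :
    (¬ 2 ∣ n → n = 1 ∨ n = 3 ∨ n = 9) ∧
      (¬ 3 ∣ n → n ∣ 64 ∧ (n ≡ 1 [MOD 3] → n = 1 ∨ n = 4 ∨ n = 16 ∨ n = 64)) := by
  have key : ∀ n ∈ Nat.divisors 576, (¬ 2 ∣ n → n = 1 ∨ n = 3 ∨ n = 9) ∧
      (¬ 3 ∣ n → n ∣ 64 ∧ (n % 3 = 1 → n = 1 ∨ n = 4 ∨ n = 16 ∨ n = 64)) := by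
    decide +kernel
  exact key n (Nat.mem_divisors.2 ⟨h, by norm_num⟩)

variable {G : Type*} [Group G] [Finite G]

theorem card_sylow_two_eq_nine (hG : IsSimpleGroup G) (hnab : ¬ ∀ a b : G, a * b = b * a)
    (hdvd : Nat.card G ∣ 576) : Nat.card (Sylow 2 G) = 9 := by
  have hn1 : Nat.card (Sylow 2 G) ≠ 1 := by
    by_cases h2 : 2 ∣ Nat.card G
    · exact card_sylow_ne_one hG hnab h2
    · have : ∃ k, Nat.card G = 3 ^ k := by
        rcases (dvd_576_cases hdvd).1 h2 with h | h | h
        · exact ⟨0, h⟩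
        · exact ⟨1, h⟩
        · exact ⟨2, h⟩
      obtain ⟨k, hk⟩ := this
      exact absurd (IsPGroup.of_card hk) (IsPGroup.false_of_isSimpleGroup hG hnab)
  obtain ⟨P⟩ : Nonempty (Sylow 2 G) := inferInstance
  have hnG : Nat.card (Sylow 2 G) ∣ Nat.card G :=
    P.card_dvd_index.trans (P : Subgroup G).index_dvd_card
  rcases (dvd_576_cases (hnG.trans hdvd)).1 (not_dvd_card_sylow 2 G) with h | h | h
  · exact absurd h hn1
  · exfalso
    have h6 : Nat.card G ∣ 6 := by
      have := card_dvd_factorial_card_sylow hG hn1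
      rwa [h] at this
    obtain ⟨R⟩ : Nonempty (Sylow 3 G) := inferInstance
    have h3 : Nat.card (Sylow 3 G) ∣ 6 :=
      (R.card_dvd_index.trans (R : Subgroup G).index_dvd_card).trans h6
    have h3' : Nat.card (Sylow 3 G) % 3 = 1 := card_sylow_modEq_one 3 G
    have key : ∀ m ∈ Nat.divisors 6, m % 3 = 1 → m = 1 := by decide
    exact card_sylow_ne_one hG hnab (h ▸ hnG) (key _ (Nat.mem_divisors.2 ⟨h3, by norm_num⟩) h3')
  · exact h

theorem not_even_card_centralizer (hG : IsSimpleGroup G) (hnab : ¬ ∀ a b : G, a * b = b * a)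
    (hn : Nat.card (Sylow 2 G) = 9) {g : G} {k : ℕ} (hg : orderOf g = 3 ^ k)
    (hfix : ∀ P : Sylow 2 G, g • P ≠ P) : ¬ 2 ∣ Nat.card (Subgroup.centralizer {g}) := by
  intro h2
  obtain ⟨t, ht⟩ := exists_prime_orderOf_dvd_card' 2 h2
  have ht2 : orderOf (t : G) = 2 := by rw [Subgroup.orderOf_coe, ht]
  have hgt := (Subgroup.mem_centralizer_singleton_iff.1 t.2).symm
  have h3 := card_fixed_sylow_modEq_zero hg hgt hfix
  have hodd := card_fixed_sylow_modEq (p := 2) ht2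
  have heven := even_card_moved_sylow_div_two (p := 2) hG hnab (t := t) (by
    rw [← ht2, pow_orderOf_eq_one])
  have hle : Nat.card {Q : Sylow 2 G // (t : G) • Q = Q} ≤ 9 := hn ▸ Nat.card_le_card_of_injective
    (Subtype.val : {Q : Sylow 2 G // (t : G) • Q = Q} → Sylow 2 G) Subtype.val_injective
  rw [hn] at hodd heven
  have h9 : Nat.card {Q : Sylow 2 G // (t : G) • Q = Q} = 9 := by
    rw [Nat.ModEq] at hodd
    generalize Nat.card {Q : Sylow 2 G // (t : G) • Q = Q} = m at *
    rw [Nat.even_iff] at heven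
    omega
  have hb := (Nat.bijective_iff_injective_and_card
    (Subtype.val : {Q : Sylow 2 G // (t : G) • Q = Q} → Sylow 2 G)).2
    ⟨Subtype.val_injective, h9.trans hn.symm⟩
  have h1 : (t : G) = 1 := eq_one_of_forall_smul_sylow_eq (p := 2) hG (by omega) fun Q => by
    obtain ⟨R, rfl⟩ := hb.2 Q
    exact R.2
  rw [h1, orderOf_one] at ht2
  omega

theorem not_card_dvd_of_isSimpleGroup (hG : IsSimpleGroup G)
    (hnab : ¬ ∀ a b : G, a * b = b * a) : ¬ Nat.card G ∣ 576 := by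
  intro hdvd
  have hn2 := card_sylow_two_eq_nine hG hnab hdvd
  have hindex2 : ∀ P : Sylow 2 G, (P : Subgroup G).index = 9 := by
    intro P
    have h1 : 9 ∣ (P : Subgroup G).index := hn2 ▸ P.card_dvd_index
    have h2 := (dvd_576_cases ((P : Subgroup G).index_dvd_card.trans hdvd)).1 P.not_dvd_index
    omega
  obtain ⟨R⟩ : Nonempty (Sylow 3 G) := inferInstance
  have h9G : 9 ∣ Nat.card G := by
    obtain ⟨P⟩ : Nonempty (Sylow 2 G) := inferInstance
    exact hindex2 P ▸ (P : Subgroup G).index_dvd_card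
  have h3G : 3 ∣ Nat.card G := (by norm_num : 3 ∣ 9).trans h9G
  have hR : ∀ R : Sylow 3 G, Nat.card R = 3 ^ 2 := by
    intro R
    obtain ⟨i, hi⟩ := IsPGroup.iff_card.1 R.isPGroup'
    have h1 : 3 ^ 2 ∣ Nat.card R := R.pow_dvd_card_of_pow_dvd_card h9G
    have h2 : Nat.card R ∣ 576 := (R : Subgroup G).card_subgroup_dvd_card.trans hdvd
    rw [hi, Nat.pow_dvd_pow_iff_le_right (by norm_num)] at h1
    have h3 : i ≤ 2 := by
      by_contra! h3
      exact absurd ((pow_dvd_pow 3 h3).trans (hi ▸ h2)) (by norm_num)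
    rw [hi, le_antisymm h3 h1]
  have hRc : ∀ R : Sylow 3 G, ∀ a ∈ R, ∀ b ∈ R, a * b = b * a := by
    intro R a ha b hb
    have := IsPGroup.isMulCommutative_of_card_eq_prime_sq (hR R)
    exact congrArg Subtype.val (this.is_comm.comm (⟨a, ha⟩ : R) ⟨b, hb⟩)
  have hRindex := (dvd_576_cases ((R : Subgroup G).index_dvd_card.trans hdvd)).2 R.not_dvd_index
  have hn3 := (dvd_576_cases ((R.card_dvd_index.trans (R : Subgroup G).index_dvd_card).trans
    hdvd)).2 (not_dvd_card_sylow 3 G) |>.2 (card_sylow_modEq_one 3 G)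
  have hn31 := card_sylow_ne_one (p := 3) hG hnab h3G
  rcases hn3 with h | h | h | h
  · exact hn31 h
  · have h1 := card_dvd_factorial_card_sylow hG hn31
    rw [h] at h1
    exact absurd (h9G.trans h1) (by decide)
  · obtain ⟨Q, hQR, g, hg1, hgR, hgQ⟩ := exists_ne_one_mem_sylow_inter (R := R) (by
      rw [hR, h]
      norm_num)
    obtain ⟨k, hk⟩ : ∃ k, orderOf g = 3 ^ k := by
      obtain ⟨k, -, hk⟩ := (Nat.dvd_prime_pow Nat.prime_three).1
        (hR R ▸ Subgroup.orderOf_dvd_natCard (R : Subgroup G) hgR)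
      exact ⟨k, hk⟩
    have hfix : ∀ P : Sylow 2 G, g • P ≠ P := by
      intro P hP
      refine hg1 (orderOf_eq_one_iff.1 ?_)
      have hN : Subgroup.normalizer (P : Set G) = P := by
        refine (Subgroup.eq_of_le_of_card_ge Subgroup.le_normalizer ?_).symm
        have h1 := (P : Subgroup G).card_mul_index
        have h2 := (Subgroup.normalizer (P : Set G)).card_mul_index
        rw [← Sylow.card_eq_index_normalizer, hn2] at h2
        rw [hindex2] at h1
        rw [P.coe_coe]
        omega
      have hgP : g ∈ (P : Subgroup G) := hN ▸ Sylow.smul_eq_iff_mem_normalizer.1 hP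
      obtain ⟨i, hi⟩ := IsPGroup.iff_card.1 P.isPGroup'
      have h1 := hi ▸ Subgroup.orderOf_dvd_natCard (P : Subgroup G) hgP
      rw [hk] at h1 ⊢
      exact Nat.Coprime.eq_one_of_dvd (Nat.Coprime.pow k i (by norm_num)) h1
    have hodd := not_even_card_centralizer hG hnab hn2 hk hfix
    have hcard := (dvd_576_cases
      ((Subgroup.centralizer {g}).card_subgroup_dvd_card.trans hdvd)).1 hodd
    have hC : ∀ S : Sylow 3 G, g ∈ S → (S : Subgroup G) = Subgroup.centralizer {g} := by
      intro S hgS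
      refine Subgroup.eq_of_le_of_card_ge (fun a ha =>
        Subgroup.mem_centralizer_singleton_iff.2 (hRc S a ha g hgS)) ?_
      rw [hR]
      omega
    exact hQR (Sylow.ext ((hC Q hgQ).trans (hC R hgR).symm))
  · refine normalizer_sylow_ne_of_commute (p := 3) hG hnab h3G (hRc R) ?_
    refine (Subgroup.eq_of_le_of_card_ge Subgroup.le_normalizer ?_).symm
    have h1 := (R : Subgroup G).card_mul_index
    have h2 := (Subgroup.normalizer (R : Set G)).card_mul_index
    rw [← Sylow.card_eq_index_normalizer, h] at h2
    have h3 := Nat.le_of_dvd (by norm_num) hRindex.1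
    have h4 : 64 ≤ (R : Subgroup G).index := by
      have := Nat.le_of_dvd (Nat.pos_of_ne_zero Subgroup.index_ne_zero_of_finite) R.card_dvd_index
      omega
    rw [le_antisymm h3 h4] at h1
    rw [R.coe_coe]
    omega

end OrderDvd576

theorem simple_group_order_dvd_imp_p_le (G : Type*) [Group G] [Finite G]
    (hsimple : IsSimpleGroup G) (hnonab : ¬ ∀ a b : G, a * b = b * a)
    (p : ℕ) (hp : p.Prime) (hdvd : Nat.card G ∣ 2 ^ 6 * 3 ^ 2 * p) :
    p ≤ 17 := by
  by_contra! hp17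
  have : Fact p.Prime := ⟨hp⟩
  have hp19 : 19 ≤ p := by
    rcases Nat.lt_or_ge p 19 with h | h
    · obtain rfl : p = 18 := by omega
      exact absurd hp (by norm_num)
    · exact h
  have hdvd' : Nat.card G ∣ 576 * p := by simpa using hdvd
  have hpG := not_dvd_card_of_isSimpleGroup hsimple hnonab hp19 hdvd'
  exact not_card_dvd_of_isSimpleGroup hsimple hnonab
    (dvd_576_of_not_dvd hp hdvd' hpG)
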